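/- For a finite set r and a tuple x, let C_{r,x} denote the collection of 4-element sets {y₁, y₂, y₃, y₄} ⊆ Set(x) ∪ r that contain at least one element of Set(x) \ r and admit an ordering with y₁ + y₂ = y₃ + y₄ and {y₁, y₂} ≠ {y₃, y₄}. For x ∈ ℕ^{2g+4} let S_x = {{x₁, x₄, x_{2l-1}, x_{2l}} : 3 ≤ l ≤ g+2} ∪ {{x_{2j-1}, x_{2j}, x_{2l-1}, x_{2l}} : 3 ≤ l < j ≤ g+2}; for x = (x₄, …, x_{2g+4}) ∈ ℕ^{2g+1} and r₁ ∈ ℕ let S_{x,r₁} = {{r₁, x₄, x_{2l-1}, x_{2l}} : 3 ≤ l ≤ g+2} ∪ {{x_{2j-1}, x_{2j}, x_{2l-1}, x_{2l}} : 3 ≤ l < j ≤ g+2}. Then there exist δ_g > 0 depending only on g and, for each λ > 1, a constant C and a threshold n₀, such that for every integer n ≥ n₀, every nonempty finite set r of positive integers ≤ n with |r| ≤ 2g+4, and every fixed integer r₁ ≥ n^{ε}: (i) ∑_{x ∈ T_n^{ind}} (∏_{i=1}^{2g+4} x_i^{-α}) · |C_{r,x} \ S_x| ≤ C · n^{-δ_g};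 and (ii) ∑_{x ∈ V_{r₁}} (∏_{i=4}^{2g+4} x_i^{-α}) · |C'_{r,x} \ S_{x,r₁}| ≤ C · n^{-δ_g}, where in (ii) Set(x) = {x₄, …, x_{2g+4}} and C'_{r,x} is formed as C_{r,x} but with ambient set Set(x) ∪ r ∪ {r₁}. The constants are independent of r and r₁. -/

import Mathlib

noncomputable section

open Real MeasureTheory ProbabilityTheory

def IsSidonZ {M : ℕ} (S : Set (ZMod M)) : Prop :=
  ∀ a ∈ S, ∀ b ∈ S, ∀ c ∈ S, ∀ d ∈ S, a + b = c + d → ({a, b} : Set (ZMod M)) = {c, d}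

def Covers3 {M : ℕ} (S : Set (ZMod M)) : Prop :=
  ∀ z : ZMod M, ∃ s₁ ∈ S, ∃ s₂ ∈ S, ∃ s₃ ∈ S,
    s₁ ≠ s₂ ∧ s₁ ≠ s₃ ∧ s₂ ≠ s₃ ∧ z = s₁ + s₂ + s₃

def alph (g : ℕ) : ℝ := ((g : ℝ) + 1) / (2 * (g : ℝ) + 1)

def glam (g : ℕ) (lam : ℝ) (n : ℕ) : ℝ :=
  lam ^ ((2 * (g : ℝ) + 5) / (1 - alph g)) * (n : ℝ) ^ ((1 : ℝ) / (g : ℝ)) *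
    Real.log n ^ ((1 : ℝ) / (1 - alph g))

def GoodS (M : ℕ) (CM : Set (ZMod M)) (s : ℕ → Fin 3 → ZMod M) : Prop :=
  ∀ n : ℕ, (∀ i, s n i ∈ CM) ∧ s n 0 ≠ s n 1 ∧ s n 0 ≠ s n 2 ∧ s n 1 ≠ s n 2 ∧
    s n 0 + s n 1 + s n 2 = (n : ZMod M)

def Rtrip (g M : ℕ) (lam : ℝ) (s : ℕ → Fin 3 → ZMod M) (n x₁ x₂ x₃ : ℕ) : Prop :=
  0 < x₁ ∧ 0 < x₂ ∧ 0 < x₃ ∧ x₁ + x₂ + x₃ = n ∧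
  glam g lam n / 2 ≤ (x₁ : ℝ) ∧ (x₁ : ℝ) ≤ glam g lam n ∧
  (n : ℝ) / 4 ≤ (x₂ : ℝ) ∧ x₂ ≤ n ∧ (n : ℝ) / 4 ≤ (x₃ : ℝ) ∧ x₃ ≤ n ∧
  (x₁ : ZMod M) = s n 0 ∧ (x₂ : ZMod M) = s n 1 ∧ (x₃ : ZMod M) = s n 2

def Rn (g M : ℕ) (lam : ℝ) (s : ℕ → Fin 3 → ZMod M) (n : ℕ) : Set (Finset ℕ) :=
  {ω | ∃ x₁ x₂ x₃ : ℕ, ω = {x₁, x₂, x₃} ∧ Rtrip g M lam s n x₁ x₂ x₃}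

def imgF {m : ℕ} (x : Fin m → ℕ) : Finset ℕ := Finset.image x Finset.univ

def firstThree (g : ℕ) (x : Fin (2 * g + 4) → ℕ) : Finset ℕ :=
  {x ⟨0, by omega⟩, x ⟨1, by omega⟩, x ⟨2, by omega⟩}

def pairOf (g : ℕ) (x : Fin (2 * g + 4) → ℕ) (j : ℕ) : Finset ℕ :=
  if j = 0 then {x ⟨0, by omega⟩, x ⟨3, by omega⟩}
  else if h : j ≤ g then {x ⟨2 * j + 2, by omega⟩, x ⟨2 * j + 3, by omega⟩}
  else ∅

def Tn (g M : ℕ) (lam : ℝ) (s : ℕ → Fin 3 → ZMod M) (n : ℕ) :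
    Set (Fin (2 * g + 4) → ℕ) :=
  {x | (∀ i, 0 < x i) ∧
    firstThree g x ∈ Rn g M lam s n ∧
    (∀ j : ℕ, 2 ≤ j → ∀ _ : j ≤ g + 1,
      x ⟨0, by omega⟩ + x ⟨3, by omega⟩ = x ⟨2 * j, by omega⟩ + x ⟨2 * j + 1, by omega⟩) ∧
    (∀ i : Fin (2 * g + 4), 3 ≤ (i : ℕ) → x i ≤ x ⟨0, by omega⟩) ∧
    (∀ k : ℕ, 2 ≤ k → ∀ _ : k ≤ g + 1,
      (x ⟨2 * k, by omega⟩ : ZMod M) = (x ⟨0, by omega⟩ : ZMod M) ∧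
      (x ⟨2 * k + 1, by omega⟩ : ZMod M) = (x ⟨3, by omega⟩ : ZMod M)) ∧
    (∀ j k : ℕ, j ≤ g → k ≤ g → j ≠ k → pairOf g x j ≠ pairOf g x k)}

def TnInd (g M : ℕ) (lam : ℝ) (s : ℕ → Fin 3 → ZMod M) (n : ℕ) :
    Set (Fin (2 * g + 4) → ℕ) :=
  {x ∈ Tn g M lam s n | Function.Injective x}

def TnDep (g M : ℕ) (lam : ℝ) (s : ℕ → Fin 3 → ZMod M) (n : ℕ) :
    Set (Fin (2 * g + 4) → ℕ) :=
  {x ∈ Tn g M lam s n | ¬ Function.Injective x}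

def Vr (g : ℕ) (r₁ : ℕ) : Set (Fin (2 * g + 1) → ℕ) :=
  {v | (∀ i, 0 < v i) ∧
    (∀ t : ℕ, ∀ _ : t < g,
      r₁ + v ⟨0, by omega⟩ = v ⟨2 * t + 1, by omega⟩ + v ⟨2 * t + 2, by omega⟩) ∧
    (∀ i, v i ≤ r₁) ∧ Function.Injective v ∧ (∀ i, v i ≠ r₁)}

def Tcal (X r : Finset ℕ) (k : ℕ) (eps : ℕ → ℤ) : Set (ℕ → ℕ) :=
  {y | (∀ j < k, y j ∈ X ∪ r) ∧ (∀ j, k ≤ j → y j = 0) ∧ (∃ j < k, y j ∈ X) ∧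
    (∀ i < k, ∀ j < k, y i = y j → eps i = eps j)}

def Fval (k : ℕ) (eps : ℕ → ℤ) (y : ℕ → ℕ) : ℤ :=
  ∑ j ∈ Finset.range k, eps j * (y j : ℤ)

def Ccal (U X r : Finset ℕ) : Set (Finset ℕ) :=
  {w | w.card = 4 ∧ w ⊆ U ∧ (∃ a ∈ w, a ∈ X ∧ a ∉ r) ∧
    ∃ y₁ y₂ y₃ y₄ : ℕ, w = {y₁, y₂, y₃, y₄} ∧ y₁ + y₂ = y₃ + y₄ ∧
      ({y₁, y₂} : Finset ℕ) ≠ {y₃, y₄}}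

def CcalR (g M : ℕ) (lam : ℝ) (s : ℕ → Fin 3 → ZMod M) (n : ℕ) (X r : Finset ℕ) :
    Set (Finset ℕ) :=
  {w | w ∈ Rn g M lam s n ∧ w ⊆ X ∪ r ∧ ∃ a ∈ w, a ∈ X ∧ a ∉ r}

def Sx (g : ℕ) (x : Fin (2 * g + 4) → ℕ) : Set (Finset ℕ) :=
  {w | ∃ l : ℕ, ∃ _ : 3 ≤ l, ∃ _ : l ≤ g + 2,
      w = ({x ⟨0, by omega⟩, x ⟨3, by omega⟩,
            x ⟨2 * l - 2, by omega⟩, x ⟨2 * l - 1, by omega⟩} : Finset ℕ)} ∪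
  {w | ∃ l j : ℕ, ∃ _ : 3 ≤ l, ∃ _ : l < j, ∃ _ : j ≤ g + 2,
      w = ({x ⟨2 * j - 2, by omega⟩, x ⟨2 * j - 1, by omega⟩,
            x ⟨2 * l - 2, by omega⟩, x ⟨2 * l - 1, by omega⟩} : Finset ℕ)}

def SxV (g : ℕ) (r₁ : ℕ) (v : Fin (2 * g + 1) → ℕ) : Set (Finset ℕ) :=
  {w | ∃ l : ℕ, ∃ _ : 3 ≤ l, ∃ _ : l ≤ g + 2,
      w = ({r₁, v ⟨0, by omega⟩, v ⟨2 * l - 5, by omega⟩, v ⟨2 * l - 4, by omega⟩} : Finset ℕ)} ∪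
  {w | ∃ l j : ℕ, ∃ _ : 3 ≤ l, ∃ _ : l < j, ∃ _ : j ≤ g + 2,
      w = ({v ⟨2 * j - 5, by omega⟩, v ⟨2 * j - 4, by omega⟩,
            v ⟨2 * l - 5, by omega⟩, v ⟨2 * l - 4, by omega⟩} : Finset ℕ)}

def tailSet (g : ℕ) (x : Fin (2 * g + 4) → ℕ) : Finset ℕ :=
  Finset.image (fun i : Fin (2 * g + 1) => x ⟨(i : ℕ) + 3, by have := i.isLt; omega⟩)
    Finset.univ

lemma alph_pos (g : ℕ) : 0 < alph g := by
  unfold alph; positivity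

lemma alph_lt_one {g : ℕ} (hg : 2 ≤ g) : alph g < 1 := by
  have : (2 : ℝ) ≤ g := by exact_mod_cast hg
  unfold alph
  rw [div_lt_one (by positivity)]
  linarith

lemma one_sub_alph (g : ℕ) : 1 - alph g = g / (2 * (g : ℝ) + 1) := by
  unfold alph
  field_simp
  ring

lemma one_sub_two_mul_alph (g : ℕ) : 1 - 2 * alph g = -(1 / (2 * (g : ℝ) + 1)) := by
  unfold alph
  field_simp
  ring

lemma sum_Icc_rpow_neg_le {a : ℝ} (ha₀ : 0 < a) (ha₁ : a < 1) (N : ℕ) :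
    ∑ i ∈ Finset.Icc 1 N, (i : ℝ) ^ (-a) ≤ (1 - a)⁻¹ * (N : ℝ) ^ (1 - a) := by
  have h1a : 0 < 1 - a := by linarith
  induction N with
  | zero => simp [Real.zero_rpow h1a.ne']
  | succ N ih =>
    rw [Finset.sum_Icc_succ_top (by omega)]
    have hpos : (0 : ℝ) < (N : ℝ) + 1 := by positivity
    have hbern : (1 + -(1 / ((N : ℝ) + 1))) ^ (1 - a) ≤ 1 + (1 - a) * -(1 / ((N : ℝ) + 1)) := by
      apply rpow_one_add_le_one_add_mul_self
      · rw [neg_le_neg_iff, div_le_one hpos]; linarith [N.cast_nonneg (α := ℝ)]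
      · linarith
      · linarith
    have hN : (N : ℝ) = ((N : ℝ) + 1) * (1 + -(1 / ((N : ℝ) + 1))) := by field_simp; ring
    have hnn : (0 : ℝ) ≤ 1 + -(1 / ((N : ℝ) + 1)) := by
      have : 1 / ((N : ℝ) + 1) ≤ 1 := by
        rw [div_le_one hpos]; linarith [N.cast_nonneg (α := ℝ)]
      linarith
    have hsplit : ((N : ℝ) + 1) ^ (-a) = ((N : ℝ) + 1) ^ (1 - a) * (1 / ((N : ℝ) + 1)) := by
      rw [show -a = (1 - a) - 1 by ring, Real.rpow_sub_one hpos.ne']; ring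
    have hNle : (N : ℝ) ^ (1 - a) ≤
        ((N : ℝ) + 1) ^ (1 - a) * (1 + (1 - a) * -(1 / ((N : ℝ) + 1))) := by
      conv_lhs => rw [hN]
      rw [Real.mul_rpow hpos.le hnn]
      gcongr
    push_cast
    rw [hsplit]
    refine (add_le_add_left ih _).trans ?_
    calc _ ≤ (1 - a)⁻¹ * (((N : ℝ) + 1) ^ (1 - a) * (1 + (1 - a) * -(1 / ((N : ℝ) + 1)))) +
          ((N : ℝ) + 1) ^ (1 - a) * (1 / ((N : ℝ) + 1)) := by gcongr
      _ = _ := by field_simp; ring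

lemma rpow_neg_mul_rpow_neg_le {a : ℝ} (ha₀ : 0 < a) {N i j : ℕ} (hi : 0 < i) (hj : 0 < j)
    (hij : i + j = N) :
    (i : ℝ) ^ (-a) * (j : ℝ) ^ (-a) ≤ ((N : ℝ) / 2) ^ (-a) := by
  have hi' : (1 : ℝ) ≤ i := by exact_mod_cast hi
  have hj' : (1 : ℝ) ≤ j := by exact_mod_cast hj
  have hN : (i : ℝ) + j = N := by exact_mod_cast hij
  have h1 : ∀ x : ℝ, 1 ≤ x → x ^ (-a) ≤ 1 := fun x hx =>
    Real.rpow_le_one_of_one_le_of_nonpos hx (by linarith)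
  rcases le_total (i : ℝ) j with h | h
  · calc _ ≤ 1 * ((N : ℝ) / 2) ^ (-a) := by
          gcongr ?_ * ?_
          · exact h1 _ hi'
          · exact Real.rpow_le_rpow_of_nonpos (by linarith) (by linarith) (by linarith)
      _ = _ := one_mul _
  · calc _ ≤ ((N : ℝ) / 2) ^ (-a) * 1 := by
          gcongr ?_ * ?_
          · exact Real.rpow_le_rpow_of_nonpos (by linarith) (by linarith) (by linarith)
          · exact h1 _ hj'
      _ = _ := mul_one _

lemma rpow_neg_mul_rpow_neg_le_add {a : ℝ} (ha₀ : 0 < a) {N i j : ℕ} (hi : 0 < i) (hj : 0 < j)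
    (hij : i + j = N) :
    (i : ℝ) ^ (-a) * (j : ℝ) ^ (-a) ≤
      ((N : ℝ) / 2) ^ (-a) * ((i : ℝ) ^ (-a) + (j : ℝ) ^ (-a)) := by
  have hi' : (1 : ℝ) ≤ i := by exact_mod_cast hi
  have hj' : (1 : ℝ) ≤ j := by exact_mod_cast hj
  have hN : (i : ℝ) + j = N := by exact_mod_cast hij
  have p1 : 0 ≤ (i : ℝ) ^ (-a) := by positivity
  have p2 : 0 ≤ (j : ℝ) ^ (-a) := by positivity
  have p3 : 0 ≤ ((N : ℝ) / 2) ^ (-a) := by positivity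
  rcases le_total (i : ℝ) j with h | h
  · have : (j : ℝ) ^ (-a) ≤ ((N : ℝ) / 2) ^ (-a) :=
      Real.rpow_le_rpow_of_nonpos (by linarith) (by linarith) (by linarith)
    nlinarith [mul_nonneg p3 p2, mul_le_mul_of_nonneg_left this p1]
  · have : (i : ℝ) ^ (-a) ≤ ((N : ℝ) / 2) ^ (-a) :=
      Real.rpow_le_rpow_of_nonpos (by linarith) (by linarith) (by linarith)
    nlinarith [mul_nonneg p3 p1, mul_le_mul_of_nonneg_right this p2]

lemma half_rpow_neg_le {a : ℝ} (ha₁ : a < 1) {x : ℝ} (hx : 0 ≤ x) :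
    (x / 2) ^ (-a) ≤ 2 * x ^ (-a) := by
  rw [Real.div_rpow hx (by norm_num), Real.rpow_neg (by norm_num : (0 : ℝ) ≤ 2), div_inv_eq_mul,
    mul_comm]
  gcongr
  calc (2 : ℝ) ^ a ≤ 2 ^ (1 : ℝ) := Real.rpow_le_rpow_of_exponent_le (by norm_num) ha₁.le
    _ = 2 := Real.rpow_one 2

lemma sum_Ioo_rpow_neg_mul_le {a : ℝ} (ha₀ : 0 < a) (ha₁ : a < 1) {N : ℕ} (hN : 0 < N) :
    ∑ i ∈ Finset.Ioo 0 N, (i : ℝ) ^ (-a) * ((N - i : ℕ) : ℝ) ^ (-a) ≤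
      4 * (1 - a)⁻¹ * (N : ℝ) ^ (1 - 2 * a) := by
  have h1a : 0 < 1 - a := by linarith
  have hN' : (0 : ℝ) < N := by exact_mod_cast hN
  have hrefl : ∑ i ∈ Finset.Ioo 0 N, ((N - i : ℕ) : ℝ) ^ (-a) =
      ∑ i ∈ Finset.Ioo 0 N, (i : ℝ) ^ (-a) := by
    refine Finset.sum_nbij' (fun i => N - i) (fun i => N - i) ?_ ?_ ?_ ?_ ?_
    all_goals
      intro i hi
      simp only [Finset.mem_Ioo] at hi ⊢
      try omega
  have hS : ∑ i ∈ Finset.Ioo 0 N, (i : ℝ) ^ (-a) ≤ (1 - a)⁻¹ * (N : ℝ) ^ (1 - a) := by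
    refine le_trans (Finset.sum_le_sum_of_subset_of_nonneg ?_ ?_) (sum_Icc_rpow_neg_le ha₀ ha₁ N)
    · intro i hi
      simp only [Finset.mem_Ioo, Finset.mem_Icc] at hi ⊢
      omega
    · intros; positivity
  have h2 := half_rpow_neg_le ha₁ hN'.le
  calc _ ≤ ∑ i ∈ Finset.Ioo 0 N,
        ((N : ℝ) / 2) ^ (-a) * ((i : ℝ) ^ (-a) + ((N - i : ℕ) : ℝ) ^ (-a)) := by
        refine Finset.sum_le_sum fun i hi => ?_
        rw [Finset.mem_Ioo] at hi
        exact rpow_neg_mul_rpow_neg_le_add ha₀ hi.1 (by omega) (by omega)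
    _ = ((N : ℝ) / 2) ^ (-a) * (2 * ∑ i ∈ Finset.Ioo 0 N, (i : ℝ) ^ (-a)) := by
        rw [← Finset.mul_sum, Finset.sum_add_distrib, hrefl, two_mul]
    _ ≤ (2 * (N : ℝ) ^ (-a)) * (2 * ((1 - a)⁻¹ * (N : ℝ) ^ (1 - a))) := by gcongr
    _ = _ := by
        rw [show 1 - 2 * a = -a + (1 - a) by ring, Real.rpow_add hN']
        ring

lemma sum_piFinset_filter_mem_le {ι : Type*} [Fintype ι] [DecidableEq ι] (S : Finset ℕ)
    (f : ℕ → ℝ) (hf : ∀ a, 0 ≤ f a) (l : ι) (D : (ι → ℕ) → Finset ℕ)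
    (hD : ∀ a y, D (Function.update a l y) = D a) (K : ℕ) (hK : ∀ a, (D a).card ≤ K)
    (B : ℝ) (hB₀ : 0 ≤ B) (hB : ∀ a ∈ S, f a ≤ B) :
    ∑ a ∈ (Fintype.piFinset fun _ : ι => S) with a l ∈ D a, ∏ t, f (a t) ≤
      K * B * (∑ a ∈ S, f a) ^ (Fintype.card ι - 1) := by
  set T : Finset (ι → ℕ) := Fintype.piFinset fun t => if t = l then {0} else S with hT
  have hmaps : ∀ a ∈ (Fintype.piFinset fun _ : ι => S).filter (fun a => a l ∈ D a),
      Function.update a l 0 ∈ T := by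
    intro a ha
    rw [Finset.mem_filter, Fintype.mem_piFinset] at ha
    rw [hT, Fintype.mem_piFinset]
    intro t
    by_cases h : t = l
    · subst h; simp
    · simpa [h] using ha.1 t
  rw [← Finset.sum_fiberwise_of_maps_to hmaps]
  have hfib : ∀ a' ∈ T, ∑ a ∈ ((Fintype.piFinset fun _ : ι => S).filter
      (fun a => a l ∈ D a)).filter (fun a => Function.update a l 0 = a'), ∏ t, f (a t) ≤
      K * B * ∏ t ∈ Finset.univ.erase l, f (a' t) := by
    intro a' _
    set F := ((Fintype.piFinset fun _ : ι => S).filter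
      (fun a => a l ∈ D a)).filter (fun a => Function.update a l 0 = a') with hF
    have hcard : F.card ≤ K := by
      refine le_trans (Finset.card_le_card_of_injOn (fun a => a l) ?_ ?_) (hK a')
      · intro a ha
        simp only [hF, Finset.coe_filter, Finset.mem_filter, Set.mem_ofPred_eq] at ha
        have := ha.1.2
        rw [← ha.2]
        simpa [hD] using this
      · intro a ha b hb hab
        simp only [hF, Finset.coe_filter, Finset.mem_filter, Set.mem_ofPred_eq] at ha hb
        have h := ha.2.trans hb.2.symm
        funext t
        by_cases ht : t = l
        · subst ht; exact hab
        · simpa [ht] using congrFun h t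
    calc _ ≤ ∑ a ∈ F, B * ∏ t ∈ Finset.univ.erase l, f (a' t) := by
          refine Finset.sum_le_sum fun a ha => ?_
          simp only [hF, Finset.mem_filter, Fintype.mem_piFinset] at ha
          rw [← Finset.mul_prod_erase _ _ (Finset.mem_univ l)]
          have : ∏ t ∈ Finset.univ.erase l, f (a t) = ∏ t ∈ Finset.univ.erase l, f (a' t) := by
            refine Finset.prod_congr rfl fun t ht => ?_
            rw [← ha.2, Function.update_of_ne (Finset.ne_of_mem_erase ht)]
          rw [this]
          exact mul_le_mul_of_nonneg_right (hB _ (ha.1.1 l)) (Finset.prod_nonneg fun _ _ => hf _)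
      _ = F.card * (B * ∏ t ∈ Finset.univ.erase l, f (a' t)) := by simp
      _ ≤ K * (B * ∏ t ∈ Finset.univ.erase l, f (a' t)) := by
          have : (0 : ℝ) ≤ ∏ t ∈ Finset.univ.erase l, f (a' t) := Finset.prod_nonneg fun _ _ => hf _
          gcongr
      _ = _ := by ring
  refine (Finset.sum_le_sum hfib).trans (le_of_eq ?_)
  rw [← Finset.mul_sum]
  congr 1
  have hprod : ∀ a' : ι → ℕ, ∏ t ∈ Finset.univ.erase l, f (a' t) =
      ∏ t, (if t = l then 1 else f (a' t)) := by
    intro a'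
    rw [← Finset.mul_prod_erase _ _ (Finset.mem_univ l)]
    simp only [if_true, one_mul]
    exact Finset.prod_congr rfl fun t ht => by rw [if_neg (Finset.ne_of_mem_erase ht)]
  simp_rw [hprod]
  rw [hT, ← Finset.prod_univ_sum (fun t => if t = l then {0} else S)
    (fun t x => if t = l then 1 else f x),
    ← Finset.mul_prod_erase _ _ (Finset.mem_univ l)]
  simp only [if_true, Finset.sum_singleton, one_mul]
  rw [Finset.prod_congr rfl (g := fun _ => ∑ a ∈ S, f a), Finset.prod_const,
    Finset.card_erase_of_mem (Finset.mem_univ l), Finset.card_univ]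
  intro t ht
  simp [Finset.ne_of_mem_erase ht]

def IsAddQuad (w : Finset ℕ) : Prop :=
  w.card = 4 ∧ ∃ y₁ y₂ y₃ y₄ : ℕ, w = {y₁, y₂, y₃, y₄} ∧ y₁ + y₂ = y₃ + y₄

lemma insert_pair_swap (p q s u : ℕ) : ({p, q, s, u} : Finset ℕ) = {s, u, p, q} := by
  ext; simp; tauto

lemma pairwise_ne_of_card_eq_four {p q s u : ℕ} (h : ({p, q, s, u} : Finset ℕ).card = 4) :
    p ≠ q ∧ p ≠ s ∧ p ≠ u ∧ q ≠ s ∧ q ≠ u ∧ s ≠ u := by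
  have key : ∀ a b c : ℕ, ({a, b, c} : Finset ℕ).card ≠ 4 := fun a b c => by
    have := Finset.card_le_three (a := a) (b := b) (c := c)
    omega
  refine ⟨?_, ?_, ?_, ?_, ?_, ?_⟩ <;> rintro rfl
  · exact key p s u (by simpa using h)
  · exact key p q u (by rw [← h]; congr 1; ext; simp; tauto)
  · exact key p q s (by rw [← h]; congr 1; ext; simp; tauto)
  · exact key p q u (by rw [← h]; congr 1; ext; simp)
  · exact key p q s (by rw [← h]; congr 1; ext; simp; tauto)
  · exact key p q s (by rw [← h]; congr 1; ext; simp)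

lemma IsAddQuad.exists_of_mem {w : Finset ℕ} (hw : IsAddQuad w) {p : ℕ} (hp : p ∈ w) :
    ∃ q s u : ℕ, w = {p, q, s, u} ∧ p + q = s + u := by
  obtain ⟨-, y₁, y₂, y₃, y₄, rfl, h⟩ := hw
  simp only [Finset.mem_insert, Finset.mem_singleton] at hp
  rcases hp with rfl | rfl | rfl | rfl
  · exact ⟨y₂, y₃, y₄, rfl, h⟩
  · exact ⟨y₁, y₃, y₄, by ext; simp; tauto, by omega⟩
  · exact ⟨y₄, y₁, y₂, by ext; simp; tauto, by omega⟩
  · exact ⟨y₃, y₁, y₂, by ext; simp; tauto, by omega⟩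

def tripleImage (Q : Finset ℕ) (f : ℕ → ℕ → ℕ → ℕ) : Finset ℕ :=
  (Q ×ˢ Q ×ˢ Q).image fun p => f p.1 p.2.1 p.2.2

lemma card_tripleImage_le {Q : Finset ℕ} {K : ℕ} (hQ : Q.card ≤ K) (f : ℕ → ℕ → ℕ → ℕ) :
    (tripleImage Q f).card ≤ K ^ 3 := by
  refine Finset.card_image_le.trans ?_
  rw [Finset.card_product, Finset.card_product]
  calc _ ≤ K * (K * K) := by gcongr
    _ = _ := by ring

lemma mem_tripleImage {Q : Finset ℕ} {f : ℕ → ℕ → ℕ → ℕ} {p q s x : ℕ} (hp : p ∈ Q) (hq : q ∈ Q)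
    (hs : s ∈ Q) (hx : x = f p q s) : x ∈ tripleImage Q f := by
  refine Finset.mem_image.2 ⟨(p, q, s), ?_, hx.symm⟩
  simp [hp, hq, hs]

def headValues (R : Finset ℕ) (c : ℕ) : Finset ℕ :=
  tripleImage (insert c R) fun p q s => p + q - s

def otherElems {g : ℕ} (R : Finset ℕ) (c z : ℕ) (a : Fin g → ℕ) (l : Fin g) : Finset ℕ :=
  {c, z} ∪ R ∪ (Finset.univ.erase l).image a ∪ (Finset.univ.erase l).image fun t => c + z - a t

def solvedValues (P : Finset ℕ) (N : ℕ) : Finset ℕ :=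
  tripleImage P (fun p q s => p + q - s) ∪ tripleImage P (fun p q s => N - (p + q - s)) ∪
    tripleImage P fun p q _ => (N + p - q) / 2

lemma card_headValues_le {R : Finset ℕ} {K : ℕ} (hR : R.card ≤ K) (c : ℕ) :
    (headValues R c).card ≤ (K + 1) ^ 3 :=
  card_tripleImage_le ((Finset.card_insert_le _ _).trans (by omega)) _

lemma card_otherElems_le {g : ℕ} {R : Finset ℕ} {K : ℕ} (hR : R.card ≤ K) (c z : ℕ)
    (a : Fin g → ℕ) (l : Fin g) : (otherElems R c z a l).card ≤ 2 + K + 2 * g := by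
  have h1 : ((Finset.univ.erase l).image a).card ≤ g :=
    Finset.card_image_le.trans ((Finset.card_erase_le).trans (by simp))
  have h2 : ((Finset.univ.erase l).image fun t => c + z - a t).card ≤ g :=
    Finset.card_image_le.trans ((Finset.card_erase_le).trans (by simp))
  have h3 : ({c, z} : Finset ℕ).card ≤ 2 := Finset.card_le_two
  unfold otherElems
  have h4 := Finset.card_union_le ({c, z} : Finset ℕ) R
  have h5 := Finset.card_union_le (({c, z} : Finset ℕ) ∪ R) ((Finset.univ.erase l).image a)
  have h6 := Finset.card_union_le (({c, z} : Finset ℕ) ∪ R ∪ ((Finset.univ.erase l).image a))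
    ((Finset.univ.erase l).image fun t => c + z - a t)
  omega

lemma card_solvedValues_le {P : Finset ℕ} {K : ℕ} (hP : P.card ≤ K) (N : ℕ) :
    (solvedValues P N).card ≤ 3 * K ^ 3 := by
  unfold solvedValues
  have h1 := card_tripleImage_le hP (fun p q s => p + q - s)
  have h2 := card_tripleImage_le hP (fun p q s => N - (p + q - s))
  have h3 := card_tripleImage_le hP (fun p q _ => (N + p - q) / 2)
  refine (Finset.card_union_le _ _).trans ?_
  have h4 := Finset.card_union_le (tripleImage P (fun p q s => p + q - s))
    (tripleImage P (fun p q s => N - (p + q - s)))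
  omega

lemma otherElems_update {g : ℕ} (R : Finset ℕ) (c z : ℕ) (a : Fin g → ℕ) (l : Fin g) (y : ℕ) :
    otherElems R c z (Function.update a l y) l = otherElems R c z a l := by
  unfold otherElems
  congr 1
  · congr 1
    refine Finset.image_congr fun t ht => ?_
    rw [Function.update_of_ne (Finset.ne_of_mem_erase ht)]
  · refine Finset.image_congr fun t ht => ?_
    rw [Function.update_of_ne (Finset.ne_of_mem_erase ht)]

lemma IsAddQuad.partner_of_notMem_solvedValues {w P : Finset ℕ} (hw : IsAddQuad w) {a b N : ℕ}
    (hab : a + b = N) (hP : ∀ y ∈ w, y ≠ a → y ≠ b → y ∈ P) (ha : a ∉ solvedValues P N)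
    {p q s u : ℕ} (hwe : w = {p, q, s, u}) (hsum : p + q = s + u) :
    (p = a → q = b) ∧ (p = b → q = a) := by
  obtain ⟨hpq, hps, hpu, hqs, hqu, hsu⟩ := pairwise_ne_of_card_eq_four (hwe ▸ hw.1)
  have hq := hP q (by simp [hwe])
  have hs := hP s (by simp [hwe])
  have hu := hP u (by simp [hwe])
  simp only [solvedValues, Finset.mem_union, not_or] at ha
  obtain ⟨⟨ha₁, ha₂⟩, ha₃⟩ := ha
  clear hP hw hwe
  constructor
  · rintro rfl
    by_contra hne
    have hqP := hq hpq.symm hne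
    by_cases h1 : s = b
    · have huP := hu hpu.symm (by omega)
      exact ha₃ (mem_tripleImage huP hqP hqP (by omega))
    have hsP := hs hps.symm h1
    by_cases h2 : u = b
    · exact ha₃ (mem_tripleImage hsP hqP hqP (by omega))
    · exact ha₁ (mem_tripleImage hsP (hu hpu.symm h2) hqP (by omega))
  · rintro rfl
    by_contra hne
    have hqP := hq hne hpq.symm
    by_cases h1 : s = a
    · have huP := hu (by omega) hpu.symm
      exact ha₃ (mem_tripleImage hqP huP hqP (by omega))
    have hsP := hs h1 hps.symm
    by_cases h2 : u = a
    · exact ha₃ (mem_tripleImage hqP hsP hqP (by omega))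
    · exact ha₂ (mem_tripleImage hsP (hu h2 hpu.symm) hqP (by omega))

lemma addQuad_head_or_solved {g : ℕ} {c z : ℕ} {a b : Fin g → ℕ} (hab : ∀ t, a t + b t = c + z)
    {R w : Finset ℕ} (hw : IsAddQuad w)
    (hsub : ∀ y ∈ w, y = c ∨ y = z ∨ (∃ t, y = a t ∨ y = b t) ∨ y ∈ R)
    (hnew : ∃ y ∈ w, (y = z ∨ ∃ t, y = a t ∨ y = b t) ∧ y ∉ R)
    (hS₁ : ∀ t, w ≠ {c, z, a t, b t})
    (hS₂ : ∀ t t', t ≠ t' → w ≠ {a t, b t, a t', b t'}) :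
    z ∈ headValues R c ∨ ∃ l, a l ∈ solvedValues (otherElems R c z a l) (c + z) := by
  by_contra hcon
  push Not at hcon
  obtain ⟨hz, hD⟩ := hcon
  have hP : ∀ l, ∀ y ∈ w, y ≠ a l → y ≠ b l → y ∈ otherElems R c z a l := by
    intro l y hy h1 h2
    unfold otherElems
    simp only [Finset.mem_union, Finset.mem_insert, Finset.mem_singleton, Finset.mem_image,
      Finset.mem_erase, Finset.mem_univ, and_true]
    rcases hsub y hy with h | h | ⟨t, h | h⟩ | h
    · simp [h]
    · simp [h]
    · have : t ≠ l := by rintro rfl; exact h1 h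
      exact Or.inl (Or.inr ⟨t, this, h.symm⟩)
    · have : t ≠ l := by rintro rfl; exact h2 h
      exact Or.inr ⟨t, this, by have := hab t; omega⟩
    · simp [h]
  have hmate : ∀ l p q s u, w = {p, q, s, u} → p + q = s + u →
      (p = a l → q = b l) ∧ (p = b l → q = a l) := fun l p q s u hwe hsum =>
    hw.partner_of_notMem_solvedValues (hab l) (hP l) (hD l) hwe hsum
  by_cases hpair : ∃ p ∈ w, ∃ l, p = a l ∨ p = b l
  · obtain ⟨l, q, s, u, hwe, hsum⟩ : ∃ l, ∃ q s u, w = {a l, q, s, u} ∧ a l + q = s + u := by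
      obtain ⟨p, hp, l, h⟩ := hpair
      obtain ⟨q, s, u, hwe, hsum⟩ := hw.exists_of_mem hp
      obtain ⟨h1, h2⟩ := hmate l p q s u hwe hsum
      rcases h with h | h
      · exact ⟨l, q, s, u, h ▸ hwe, h ▸ hsum⟩
      · refine ⟨l, p, s, u, ?_, by have := h2 h; omega⟩
        rw [hwe, h2 h]
        exact Finset.insert_comm _ _ _
    obtain rfl := (hmate l _ q s u hwe hsum).1 rfl
    obtain ⟨-, hps, hpu, hqs, hqu, hsu⟩ := pairwise_ne_of_card_eq_four (hwe ▸ hw.1)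
    have hl := hab l
    have hnS : ∀ j s u, w = {a l, b l, s, u} → a l + b l = s + u → s ≠ a l → s ≠ b l →
        ¬ (s = a j ∨ s = b j) := by
      intro j s u hwe hsum hsa hsb h
      have hwe' : w = {s, u, a l, b l} := hwe.trans (insert_pair_swap _ _ _ _)
      obtain ⟨h1, h2⟩ := hmate j s u _ _ hwe' hsum.symm
      have hjl : l ≠ j := by
        rintro rfl
        exact h.elim hsa hsb
      refine hS₂ l j hjl ?_
      rcases h with h | h
      · rw [hwe, h1 h, h]
      · rw [hwe, h2 h, h, Finset.pair_comm (b j)]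
    have hwe' : w = {a l, b l, u, s} := by rw [hwe, Finset.pair_comm s]
    have hs1 := fun j => hnS j s u hwe hsum hps.symm hqs.symm
    have hu1 := fun j => hnS j u s hwe' (by omega) hpu.symm hqu.symm
    have hcz : ∀ s u, w = {a l, b l, s, u} → s + u = c + z → s = c → False := by
      rintro s u hwe hsum rfl
      obtain rfl : u = z := by omega
      exact hS₁ l (hwe.trans (insert_pair_swap _ _ _ _))
    rcases hsub s (by simp [hwe]) with h | h | ⟨t, h⟩ | hs
    · exact hcz s u hwe (by omega) h
    · exact hcz u s hwe' (by omega) (by omega)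
    · exact hs1 t h
    rcases hsub u (by simp [hwe]) with h | h | ⟨t, h⟩ | hu
    · exact hcz u s hwe' (by omega) h
    · exact hcz s u hwe (by omega) (by omega)
    · exact hu1 t h
    exact hz (mem_tripleImage (p := s) (q := u) (s := c) (by simp [hs]) (by simp [hu]) (by simp)
      (by omega))
  · push Not at hpair
    have hsub' : ∀ y ∈ w, y ≠ z → y ∈ insert c R := by
      intro y hy hyz
      rw [Finset.mem_insert]
      rcases hsub y hy with h | h | ⟨t, h⟩ | h
      · exact Or.inl h
      · exact absurd h hyz
      · exact (h.elim (hpair y hy t).1 (hpair y hy t).2).elim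
      · exact Or.inr h
    obtain ⟨y, hy, h | ⟨t, h⟩, -⟩ := hnew
    · subst h
      obtain ⟨q, s, u, hwe, hsum⟩ := hw.exists_of_mem hy
      obtain ⟨h1, h2, h3, -⟩ := pairwise_ne_of_card_eq_four (hwe ▸ hw.1)
      exact hz (mem_tripleImage (hsub' s (by simp [hwe]) h2.symm) (hsub' u (by simp [hwe]) h3.symm)
        (hsub' q (by simp [hwe]) h1.symm) (by omega))
    · exact (h.elim (hpair y hy t).1 (hpair y hy t).2).elim

lemma Ccal.isAddQuad {U X r w : Finset ℕ} (hw : w ∈ Ccal U X r) : IsAddQuad w := by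
  obtain ⟨h4, -, -, y₁, y₂, y₃, y₄, h, hs, -⟩ := hw
  exact ⟨h4, y₁, y₂, y₃, y₄, h, hs⟩

lemma mem_imgF_iff {m : ℕ} {x : Fin m → ℕ} {y : ℕ} : y ∈ imgF x ↔ ∃ i, x i = y := by
  simp [imgF]

def headOf (g : ℕ) (v : Fin (2 * g + 1) → ℕ) : ℕ := v ⟨0, by omega⟩

def oddPart (g : ℕ) (v : Fin (2 * g + 1) → ℕ) (t : Fin g) : ℕ := v ⟨2 * t + 1, by omega⟩

def evenPart (g : ℕ) (v : Fin (2 * g + 1) → ℕ) (t : Fin g) : ℕ := v ⟨2 * t + 2, by omega⟩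

lemma eq_headOf_or {g : ℕ} (v : Fin (2 * g + 1) → ℕ) (i : Fin (2 * g + 1)) :
    v i = headOf g v ∨ ∃ t, v i = oddPart g v t ∨ v i = evenPart g v t := by
  obtain ⟨i, hi⟩ := i
  rcases Nat.eq_zero_or_pos i with rfl | h0
  · exact Or.inl rfl
  · right
    rcases Nat.even_or_odd' i with ⟨k, rfl | rfl⟩
    · obtain ⟨k, rfl⟩ : ∃ k', k = k' + 1 := ⟨k - 1, by omega⟩
      exact ⟨⟨k, by omega⟩, Or.inr rfl⟩
    · exact ⟨⟨k, by omega⟩, Or.inl rfl⟩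

lemma Vr.head_or_solved {g r₁ : ℕ} {v : Fin (2 * g + 1) → ℕ} (hv : v ∈ Vr g r₁)
    {r w : Finset ℕ} (hw : w ∈ Ccal (imgF v ∪ r ∪ {r₁}) (imgF v) r) (hwS : w ∉ SxV g r₁ v) :
    headOf g v ∈ headValues r r₁ ∨ ∃ l, oddPart g v l ∈
      solvedValues (otherElems r r₁ (headOf g v) (oddPart g v) l) (r₁ + headOf g v) := by
  obtain ⟨-, hsum, -, -, -⟩ := hv
  refine addQuad_head_or_solved (b := evenPart g v) (fun t => (hsum t t.2).symm)
    (Ccal.isAddQuad hw) ?_ ?_ ?_ ?_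
  · intro y hy
    have := hw.2.1 hy
    simp only [Finset.mem_union, Finset.mem_singleton, mem_imgF_iff] at this
    rcases this with (⟨i, rfl⟩ | h) | h
    · rcases eq_headOf_or v i with h | h
      · exact Or.inr (Or.inl h)
      · exact Or.inr (Or.inr (Or.inl h))
    · tauto
    · tauto
  · obtain ⟨y, hy, hyX, hyr⟩ := hw.2.2.1
    obtain ⟨i, rfl⟩ := mem_imgF_iff.1 hyX
    exact ⟨_, hy, eq_headOf_or v i, hyr⟩
  · rintro ⟨t, ht⟩ h
    have e1 : 2 * (t + 3) - 5 = 2 * t + 1 := by omega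
    have e2 : 2 * (t + 3) - 4 = 2 * t + 2 := by omega
    refine hwS (Or.inl ⟨t + 3, by omega, by omega, h.trans ?_⟩)
    simp only [headOf, oddPart, evenPart, e1, e2]
  · have key : ∀ t t' : Fin g, (t : ℕ) < t' →
        w ≠ {oddPart g v t', evenPart g v t', oddPart g v t, evenPart g v t} := by
      rintro ⟨t, ht⟩ ⟨t', ht'⟩ hlt h
      have e1 : 2 * (t + 3) - 5 = 2 * t + 1 := by omega
      have e2 : 2 * (t + 3) - 4 = 2 * t + 2 := by omega
      have e3 : 2 * (t' + 3) - 5 = 2 * t' + 1 := by omega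
      have e4 : 2 * (t' + 3) - 4 = 2 * t' + 2 := by omega
      refine hwS (Or.inr ⟨t + 3, t' + 3, by omega, by simpa using hlt, by omega, h.trans ?_⟩)
      simp only [oddPart, evenPart, e1, e2, e3, e4]
    intro t t' hne h
    rcases lt_or_gt_of_ne (fun h' => hne (Fin.ext h') : (t : ℕ) ≠ t') with h' | h'
    · exact key t t' h' (h.trans (insert_pair_swap _ _ _ _))
    · exact key t' t h' h

lemma Vr_finite (g r₁ : ℕ) : (Vr g r₁).Finite :=
  (Set.finite_Icc (0 : Fin (2 * g + 1) → ℕ) fun _ => r₁).subset fun _ hv =>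
    ⟨fun _ => Nat.zero_le _, hv.2.2.1⟩

def tailWeight (g : ℕ) (v : Fin (2 * g + 1) → ℕ) : ℝ := ∏ i, (v i : ℝ) ^ (-alph g)

lemma tailWeight_nonneg (g : ℕ) (v : Fin (2 * g + 1) → ℕ) : 0 ≤ tailWeight g v :=
  Finset.prod_nonneg fun _ _ => by positivity

lemma prod_range_two_mul_add_one (F : ℕ → ℝ) (m : ℕ) :
    ∏ i ∈ Finset.range (2 * m + 1), F i =
      F 0 * ∏ t ∈ Finset.range m, (F (2 * t + 1) * F (2 * t + 2)) := by
  induction m with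
  | zero => simp
  | succ m ih =>
    rw [show 2 * (m + 1) + 1 = 2 * m + 1 + 1 + 1 by ring, Finset.prod_range_succ,
      Finset.prod_range_succ, ih, Finset.prod_range_succ]
    ring

lemma tailWeight_eq (g : ℕ) (v : Fin (2 * g + 1) → ℕ) :
    tailWeight g v = (headOf g v : ℝ) ^ (-alph g) *
      ∏ t, ((oddPart g v t : ℝ) ^ (-alph g) * (evenPart g v t : ℝ) ^ (-alph g)) := by
  unfold tailWeight
  rw [Finset.prod_fin_eq_prod_range, prod_range_two_mul_add_one, Finset.prod_fin_eq_prod_range]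
  congr 1
  refine Finset.prod_congr rfl fun t ht => ?_
  rw [Finset.mem_range] at ht
  rw [dif_pos (by omega), dif_pos (by omega), dif_pos ht]
  rfl

def convTerm (g N i : ℕ) : ℝ := (i : ℝ) ^ (-alph g) * ((N - i : ℕ) : ℝ) ^ (-alph g)

lemma convTerm_nonneg (g N i : ℕ) : 0 ≤ convTerm g N i := by unfold convTerm; positivity

lemma sum_tailWeight_le_of_forall {g r₁ : ℕ} {A : Finset (Fin (2 * g + 1) → ℕ)}
    (hA : ∀ v ∈ A, v ∈ Vr g r₁) (p : ℕ → (Fin g → ℕ) → Prop) [∀ z, DecidablePred (p z)]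
    (hp : ∀ v ∈ A, p (headOf g v) (oddPart g v)) :
    ∑ v ∈ A, tailWeight g v ≤ ∑ z ∈ Finset.Icc 1 r₁, (z : ℝ) ^ (-alph g) *
      ∑ a ∈ (Fintype.piFinset fun _ : Fin g => Finset.Ioo 0 (r₁ + z)) with p z a,
        ∏ t, convTerm g (r₁ + z) (a t) := by
  simp_rw [Finset.mul_sum]
  rw [Finset.sum_sigma']
  set Φ : (Fin (2 * g + 1) → ℕ) → (_ : ℕ) × (Fin g → ℕ) := fun v => ⟨headOf g v, oddPart g v⟩
  have heven : ∀ v ∈ A, ∀ t, evenPart g v t = r₁ + headOf g v - oddPart g v t := by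
    intro v hv t
    have h : r₁ + headOf g v = oddPart g v t + evenPart g v t := (hA v hv).2.1 t t.2
    omega
  have hinj : Set.InjOn Φ A := by
    intro v hv v' hv' h
    have h1 : headOf g v = headOf g v' := congrArg (·.1) h
    have h2 : oddPart g v = oddPart g v' := congrArg (·.2) h
    funext i
    obtain ⟨i, hi⟩ := i
    rcases Nat.eq_zero_or_pos i with rfl | h0
    · exact h1
    rcases Nat.even_or_odd' i with ⟨k, rfl | rfl⟩
    · obtain ⟨k, rfl⟩ : ∃ k', k = k' + 1 := ⟨k - 1, by omega⟩
      have h3 := heven v hv ⟨k, by omega⟩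
      have h4 := heven v' hv' ⟨k, by omega⟩
      rw [h1, h2, ← h4] at h3
      exact h3
    · exact congrFun h2 ⟨k, by omega⟩
  have hval : ∀ v ∈ A, tailWeight g v = (fun q : (_ : ℕ) × (Fin g → ℕ) =>
      (q.1 : ℝ) ^ (-alph g) * ∏ t, convTerm g (r₁ + q.1) (q.2 t)) (Φ v) := by
    intro v hv
    rw [tailWeight_eq]
    simp only [Φ, convTerm]
    congr 1
    exact Finset.prod_congr rfl fun t _ => by rw [heven v hv]
  rw [Finset.sum_congr rfl hval, ← Finset.sum_image (f := fun q : (_ : ℕ) × (Fin g → ℕ) =>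
      (q.1 : ℝ) ^ (-alph g) * ∏ t, convTerm g (r₁ + q.1) (q.2 t)) hinj]
  refine Finset.sum_le_sum_of_subset_of_nonneg ?_ fun q _ _ =>
    mul_nonneg (by positivity) (Finset.prod_nonneg fun _ _ => convTerm_nonneg _ _ _)
  intro q hq
  obtain ⟨v, hv, rfl⟩ := Finset.mem_image.1 hq
  obtain ⟨hpos, hsum, hle, -, -⟩ := hA v hv
  simp only [Finset.mem_sigma, Finset.mem_filter, Fintype.mem_piFinset, Finset.mem_Icc,
    Finset.mem_Ioo, Φ]
  refine ⟨⟨hpos _, hle _⟩, fun t => ⟨hpos _, ?_⟩, hp v hv⟩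
  have h : r₁ + headOf g v = oddPart g v t + evenPart g v t := hsum t t.2
  have : 0 < evenPart g v t := hpos _
  omega

lemma rpow_one_sub_two_mul_alph_pow {g : ℕ} {x : ℝ} (hx : 0 ≤ x) :
    (x ^ (1 - 2 * alph g)) ^ g = x ^ (-(1 - alph g)) := by
  rw [← Real.rpow_natCast, ← Real.rpow_mul hx, one_sub_alph, one_sub_two_mul_alph]
  congr 1
  ring

lemma sum_convTerm_le {g : ℕ} (hg : 2 ≤ g) {r₁ : ℕ} (hr₁ : 0 < r₁) (z : ℕ) :
    ∑ i ∈ Finset.Ioo 0 (r₁ + z), convTerm g (r₁ + z) i ≤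
      4 * (1 - alph g)⁻¹ * (r₁ : ℝ) ^ (1 - 2 * alph g) := by
  have h1 := alph_lt_one hg
  have hr : (0 : ℝ) < r₁ := by exact_mod_cast hr₁
  refine (sum_Ioo_rpow_neg_mul_le (alph_pos g) h1 (N := r₁ + z) (by omega)).trans ?_
  have h2 : 0 < 1 - alph g := by linarith
  gcongr ?_ * ?_
  refine Real.rpow_le_rpow_of_nonpos hr (by push_cast; linarith [z.cast_nonneg (α := ℝ)]) ?_
  rw [one_sub_two_mul_alph, neg_nonpos]
  positivity

lemma convTerm_le {g : ℕ} (hg : 2 ≤ g) {r₁ : ℕ} (hr₁ : 0 < r₁) {z i : ℕ}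
    (hi : i ∈ Finset.Ioo 0 (r₁ + z)) : convTerm g (r₁ + z) i ≤ 2 * (r₁ : ℝ) ^ (-alph g) := by
  rw [Finset.mem_Ioo] at hi
  have hr : (0 : ℝ) < r₁ := by exact_mod_cast hr₁
  refine (rpow_neg_mul_rpow_neg_le (alph_pos g) hi.1 (by omega)
    (show i + (r₁ + z - i) = r₁ + z by omega)).trans ?_
  refine le_trans ?_ (half_rpow_neg_le (alph_lt_one hg) hr.le)
  refine Real.rpow_le_rpow_of_nonpos (by positivity) ?_ (by linarith [alph_pos g])
  push_cast
  linarith [z.cast_nonneg (α := ℝ)]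

lemma sum_prod_convTerm_le {g : ℕ} (hg : 2 ≤ g) {r₁ : ℕ} (hr₁ : 0 < r₁) (z : ℕ) :
    ∑ a ∈ Fintype.piFinset fun _ : Fin g => Finset.Ioo 0 (r₁ + z),
      ∏ t, convTerm g (r₁ + z) (a t) ≤
      (4 * (1 - alph g)⁻¹) ^ g * (r₁ : ℝ) ^ (-(1 - alph g)) := by
  rw [← Finset.prod_univ_sum (fun _ : Fin g => Finset.Ioo 0 (r₁ + z))
    (fun _ i => convTerm g (r₁ + z) i), Finset.prod_const, Finset.card_univ, Fintype.card_fin,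
    ← rpow_one_sub_two_mul_alph_pow (Nat.cast_nonneg r₁), ← mul_pow]
  exact pow_le_pow_left₀ (Finset.sum_nonneg fun _ _ => convTerm_nonneg _ _ _)
    (sum_convTerm_le hg hr₁ z) g

lemma sum_tailWeight_le {g : ℕ} (hg : 2 ≤ g) {r₁ : ℕ} (hr₁ : 0 < r₁)
    {A : Finset (Fin (2 * g + 1) → ℕ)} (hA : ∀ v ∈ A, v ∈ Vr g r₁) :
    ∑ v ∈ A, tailWeight g v ≤ (1 - alph g)⁻¹ * (4 * (1 - alph g)⁻¹) ^ g := by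
  have h1 := alph_lt_one hg
  have h2 : 0 < 1 - alph g := by linarith
  have hr : (0 : ℝ) < r₁ := by exact_mod_cast hr₁
  refine (sum_tailWeight_le_of_forall hA (fun _ _ => True) fun _ _ => trivial).trans ?_
  calc _ ≤ ∑ z ∈ Finset.Icc 1 r₁, (z : ℝ) ^ (-alph g) *
        ((4 * (1 - alph g)⁻¹) ^ g * (r₁ : ℝ) ^ (-(1 - alph g))) := by
        refine Finset.sum_le_sum fun z _ => ?_
        rw [Finset.filter_true]
        gcongr
        exact sum_prod_convTerm_le hg hr₁ z
    _ = (∑ z ∈ Finset.Icc 1 r₁, (z : ℝ) ^ (-alph g)) *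
        ((4 * (1 - alph g)⁻¹) ^ g * (r₁ : ℝ) ^ (-(1 - alph g))) := by rw [Finset.sum_mul]
    _ ≤ (1 - alph g)⁻¹ * (r₁ : ℝ) ^ (1 - alph g) *
        ((4 * (1 - alph g)⁻¹) ^ g * (r₁ : ℝ) ^ (-(1 - alph g))) := by
        gcongr
        exact sum_Icc_rpow_neg_le (alph_pos g) h1 r₁
    _ = _ := by
        rw [Real.rpow_neg hr.le]
        field_simp

lemma sum_tailWeight_le_of_headOf_mem {g : ℕ} (hg : 2 ≤ g) {r₁ : ℕ} (hr₁ : 0 < r₁)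
    {A : Finset (Fin (2 * g + 1) → ℕ)} (hA : ∀ v ∈ A, v ∈ Vr g r₁) (H : Finset ℕ)
    (hH : ∀ v ∈ A, headOf g v ∈ H) :
    ∑ v ∈ A, tailWeight g v ≤
      H.card * (4 * (1 - alph g)⁻¹) ^ g * (r₁ : ℝ) ^ (-(1 - alph g)) := by
  have h1 := alph_lt_one hg
  have h2 : 0 < 1 - alph g := by linarith
  refine (sum_tailWeight_le_of_forall hA (fun z _ => z ∈ H) hH).trans ?_
  set B := (4 * (1 - alph g)⁻¹) ^ g * (r₁ : ℝ) ^ (-(1 - alph g)) with hB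
  have hB₀ : 0 ≤ B := by positivity
  calc _ ≤ ∑ z ∈ Finset.Icc 1 r₁, if z ∈ H then B else 0 := by
        refine Finset.sum_le_sum fun z hz => ?_
        rw [Finset.mem_Icc] at hz
        by_cases h : z ∈ H
        · simp only [h, Finset.filter_true, if_true]
          have hz1 : (z : ℝ) ^ (-alph g) ≤ 1 :=
            Real.rpow_le_one_of_one_le_of_nonpos (by exact_mod_cast hz.1)
              (by linarith [alph_pos g])
          calc _ ≤ 1 * B := mul_le_mul hz1 (sum_prod_convTerm_le hg hr₁ z)
                (Finset.sum_nonneg fun _ _ => Finset.prod_nonneg fun _ _ => convTerm_nonneg _ _ _)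
                zero_le_one
            _ = B := one_mul B
        · simp [h]
    _ = ((Finset.Icc 1 r₁).filter (· ∈ H)).card * B := by
        rw [← Finset.sum_filter, Finset.sum_const, nsmul_eq_mul]
    _ ≤ H.card * B := by
        gcongr
        intro z hz
        exact (Finset.mem_filter.1 hz).2
    _ = _ := by rw [hB, mul_assoc]

lemma sum_tailWeight_le_of_oddPart_mem {g : ℕ} (hg : 2 ≤ g) {r₁ : ℕ} (hr₁ : 0 < r₁)
    {A : Finset (Fin (2 * g + 1) → ℕ)} (hA : ∀ v ∈ A, v ∈ Vr g r₁) (l : Fin g)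
    (D : ℕ → (Fin g → ℕ) → Finset ℕ) (hD : ∀ z a y, D z (Function.update a l y) = D z a)
    (K : ℕ) (hK : ∀ z a, (D z a).card ≤ K)
    (hAD : ∀ v ∈ A, oddPart g v l ∈ D (headOf g v) (oddPart g v)) :
    ∑ v ∈ A, tailWeight g v ≤
      K * 2 * (1 - alph g)⁻¹ * (4 * (1 - alph g)⁻¹) ^ (g - 1) * (r₁ : ℝ) ^ (-(1 - alph g)) := by
  have h1 := alph_lt_one hg
  have h2 : 0 < 1 - alph g := by linarith
  have hr : (0 : ℝ) < r₁ := by exact_mod_cast hr₁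
  refine (sum_tailWeight_le_of_forall hA (fun z a => a l ∈ D z a) hAD).trans ?_
  set x := (r₁ : ℝ) ^ (1 - 2 * alph g) with hx
  calc _ ≤ ∑ z ∈ Finset.Icc 1 r₁, (z : ℝ) ^ (-alph g) *
        (K * (2 * (r₁ : ℝ) ^ (-alph g)) * (4 * (1 - alph g)⁻¹ * x) ^ (g - 1)) := by
        refine Finset.sum_le_sum fun z _ => ?_
        gcongr
        refine (sum_piFinset_filter_mem_le _ _ (fun _ => convTerm_nonneg _ _ _) l (D z) (hD z) K
          (hK z) (2 * (r₁ : ℝ) ^ (-alph g)) (by positivity)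
          (fun i hi => convTerm_le hg hr₁ hi)).trans ?_
        rw [Fintype.card_fin]
        gcongr
        · exact Finset.sum_nonneg fun _ _ => convTerm_nonneg _ _ _
        · exact sum_convTerm_le hg hr₁ z
    _ = (∑ z ∈ Finset.Icc 1 r₁, (z : ℝ) ^ (-alph g)) *
        (K * (2 * (r₁ : ℝ) ^ (-alph g)) * (4 * (1 - alph g)⁻¹ * x) ^ (g - 1)) := by
        rw [Finset.sum_mul]
    _ ≤ (1 - alph g)⁻¹ * (r₁ : ℝ) ^ (1 - alph g) *
        (K * (2 * (r₁ : ℝ) ^ (-alph g)) * (4 * (1 - alph g)⁻¹ * x) ^ (g - 1)) := by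
        gcongr
        exact sum_Icc_rpow_neg_le (alph_pos g) h1 r₁
    _ = K * 2 * (1 - alph g)⁻¹ * (4 * (1 - alph g)⁻¹) ^ (g - 1) *
        (((r₁ : ℝ) ^ (1 - alph g) * (r₁ : ℝ) ^ (-alph g)) * x ^ (g - 1)) := by
        rw [mul_pow _ x]; ring
    _ = _ := by
        rw [← Real.rpow_add hr, show 1 - alph g + -alph g = 1 - 2 * alph g by ring, ← hx,
          ← pow_succ', Nat.sub_add_cancel (by omega), hx,
          rpow_one_sub_two_mul_alph_pow (Nat.cast_nonneg r₁)]

def IsDegenerate (g r₁ : ℕ) (R : Finset ℕ) (v : Fin (2 * g + 1) → ℕ) : Prop :=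
  headOf g v ∈ headValues R r₁ ∨ ∃ l, oddPart g v l ∈
    solvedValues (otherElems R r₁ (headOf g v) (oddPart g v) l) (r₁ + headOf g v)

lemma exists_sum_tailWeight_degenerate_le {g : ℕ} (hg : 2 ≤ g) (K : ℕ) :
    ∃ C : ℝ, 0 < C ∧ ∀ r₁ : ℕ, 0 < r₁ → ∀ R : Finset ℕ, R.card ≤ K →
      ∀ A : Finset (Fin (2 * g + 1) → ℕ), (∀ v ∈ A, v ∈ Vr g r₁) →
        (∀ v ∈ A, IsDegenerate g r₁ R v) →
        ∑ v ∈ A, tailWeight g v ≤ C * (r₁ : ℝ) ^ (-(1 - alph g)) := by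
  have h1 := alph_lt_one hg
  have h2 : 0 < 1 - alph g := by linarith
  refine ⟨((K + 1) ^ 3 : ℕ) * (4 * (1 - alph g)⁻¹) ^ g + g * (((3 * (2 + K + 2 * g) ^ 3 : ℕ) : ℝ) *
    2 * (1 - alph g)⁻¹ * (4 * (1 - alph g)⁻¹) ^ (g - 1)), by positivity, ?_⟩
  intro r₁ hr₁ R hR A hA hdeg
  classical
  set D : Fin g → ℕ → (Fin g → ℕ) → Finset ℕ := fun l z a =>
    solvedValues (otherElems R r₁ z a l) (r₁ + z) with hDdef
  set A₀ := A.filter fun v => headOf g v ∈ headValues R r₁ with hA₀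
  set A₁ : Fin g → Finset (Fin (2 * g + 1) → ℕ) := fun l =>
    A.filter fun v => oddPart g v l ∈ D l (headOf g v) (oddPart g v) with hA₁
  have hsplit : ∑ v ∈ A, tailWeight g v ≤
      ∑ v ∈ A₀, tailWeight g v + ∑ l, ∑ v ∈ A₁ l, tailWeight g v := by
    simp only [hA₀, hA₁, Finset.sum_filter]
    rw [Finset.sum_comm, ← Finset.sum_add_distrib]
    refine Finset.sum_le_sum fun v hv => ?_
    have hw := tailWeight_nonneg g v
    have hnn : ∀ l ∈ Finset.univ, 0 ≤ if oddPart g v l ∈ D l (headOf g v) (oddPart g v)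
        then tailWeight g v else 0 := fun l _ => by split_ifs <;> simp [hw]
    rcases hdeg v hv with h | ⟨l, h⟩
    · rw [if_pos h]
      linarith [Finset.sum_nonneg hnn]
    · have h3 := Finset.single_le_sum hnn (Finset.mem_univ l)
      rw [if_pos h] at h3
      refine h3.trans (le_add_of_nonneg_left ?_)
      split_ifs <;> simp [hw]
  refine hsplit.trans ?_
  rw [add_mul]
  refine add_le_add ?_ ?_
  · refine (sum_tailWeight_le_of_headOf_mem hg hr₁ (fun v hv => hA v (Finset.mem_filter.1 hv).1)
      (headValues R r₁) (fun v hv => (Finset.mem_filter.1 hv).2)).trans ?_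
    gcongr
    exact card_headValues_le hR r₁
  · rw [mul_assoc]
    refine (Finset.sum_le_card_nsmul _ _ _ fun l _ => ?_).trans
      (le_of_eq (by rw [Finset.card_univ, Fintype.card_fin, nsmul_eq_mul]))
    refine sum_tailWeight_le_of_oddPart_mem hg hr₁ (fun v hv => hA v (Finset.mem_filter.1 hv).1) l
      (D l) ?_ _ ?_ (fun v hv => (Finset.mem_filter.1 hv).2)
    · intro z a y
      simp only [hDdef, otherElems_update]
    · intro z a
      exact card_solvedValues_le (card_otherElems_le hR _ _ _ _) _

lemma ncard_Ccal_diff_le {U X r : Finset ℕ} {S : Set (Finset ℕ)} {K : ℕ} (hU : U.card ≤ K) :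
    (Ccal U X r \ S).ncard ≤ 2 ^ K := by
  calc _ ≤ (U.powerset : Set (Finset ℕ)).ncard :=
        Set.ncard_le_ncard (fun w hw => by simpa using hw.1.2.1) (Finset.finite_toSet _)
    _ = 2 ^ U.card := by rw [Set.ncard_coe_finset, Finset.card_powerset]
    _ ≤ 2 ^ K := Nat.pow_le_pow_right (by norm_num) hU

lemma Set.Finite.tsum_subtype_eq_sum {β : Type*} {S : Set β} (hS : S.Finite) (F : β → ℝ) :
    ∑' x : ↥S, F x.1 = ∑ x ∈ hS.toFinset, F x := by
  conv_lhs => rw [← hS.coe_toFinset]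
  exact Finset.tsum_subtype' hS.toFinset F

lemma card_imgF_le {m : ℕ} (x : Fin m → ℕ) : (imgF x).card ≤ m :=
  Finset.card_image_le.trans (by simp)

lemma sum_mul_ncard_le {β : Type*} (A : Finset β) (W : β → ℝ) (hW : ∀ x, 0 ≤ W x)
    (S : β → Set (Finset ℕ)) (K : ℕ) (hK : ∀ x, (S x).ncard ≤ K)
    (P : β → Prop) [DecidablePred P] (hP : ∀ x ∈ A, (S x).Nonempty → P x) :
    ∑ x ∈ A, W x * ((S x).ncard : ℝ) ≤ K * ∑ x ∈ A with P x, W x := by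
  rw [Finset.mul_sum, Finset.sum_filter]
  refine Finset.sum_le_sum fun x hx => ?_
  split_ifs with h
  · rw [mul_comm]
    have := hW x
    gcongr
    exact hK x
  · rw [Set.not_nonempty_iff_eq_empty.1 fun h' => h (hP x hx h')]
    simp

theorem exists_tsum_Vr_le {g : ℕ} (hg : 2 ≤ g) :
    ∃ C : ℝ, 0 < C ∧ ∀ r₁ : ℕ, 0 < r₁ → ∀ r : Finset ℕ, r.card ≤ 2 * g + 4 →
      (∑' v : ↥(Vr g r₁), (∏ i : Fin (2 * g + 1), (v.1 i : ℝ) ^ (-alph g)) *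
        ((Ccal (imgF v.1 ∪ r ∪ {r₁}) (imgF v.1) r \ SxV g r₁ v.1).ncard : ℝ)) ≤
      C * (r₁ : ℝ) ^ (-(1 - alph g)) := by
  classical
  obtain ⟨C, hC, h⟩ := exists_sum_tailWeight_degenerate_le hg (2 * g + 4)
  refine ⟨(2 ^ (4 * g + 6) : ℕ) * C, by positivity, fun r₁ hr₁ r hr => ?_⟩
  refine ((Vr_finite g r₁).tsum_subtype_eq_sum fun v => tailWeight g v *
    ((Ccal (imgF v ∪ r ∪ {r₁}) (imgF v) r \ SxV g r₁ v).ncard : ℝ)).trans_le ?_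
  have hmem : ∀ v ∈ (Vr_finite g r₁).toFinset, v ∈ Vr g r₁ := fun v hv => by simpa using hv
  refine (sum_mul_ncard_le _ _ (tailWeight_nonneg g) _ (2 ^ (4 * g + 6)) (fun v => ?_)
    (IsDegenerate g r₁ r) ?_).trans ?_
  · refine ncard_Ccal_diff_le ?_
    have h1 := Finset.card_union_le (imgF v ∪ r) {r₁}
    have h2 := Finset.card_union_le (imgF v) r
    have h3 := card_imgF_le v
    rw [Finset.card_singleton] at h1
    omega
  · rintro v hv ⟨w, hw, hwS⟩
    exact Vr.head_or_solved (hmem v hv) hw hwS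
  · rw [mul_assoc]
    gcongr
    exact h r₁ hr₁ r hr _ (fun v hv => hmem v (Finset.mem_filter.1 hv).1)
      (fun v hv => (Finset.mem_filter.1 hv).2)

def tripleWeight (g : ℕ) (p : ℕ × ℕ × ℕ) : ℝ :=
  (p.1 : ℝ) ^ (-alph g) * (p.2.1 : ℝ) ^ (-alph g) * (p.2.2 : ℝ) ^ (-alph g)

lemma tripleWeight_nonneg (g : ℕ) (p : ℕ × ℕ × ℕ) : 0 ≤ tripleWeight g p := by
  unfold tripleWeight; positivity

def orderedTriples (g : ℕ) (lam : ℝ) (n : ℕ) : Finset (ℕ × ℕ × ℕ) :=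
  (Finset.Icc 1 n ×ˢ Finset.Icc 1 n ×ˢ Finset.Icc 1 n).filter fun p =>
    p.1 + p.2.1 + p.2.2 = n ∧ glam g lam n / 2 ≤ p.1 ∧ (p.1 : ℝ) ≤ glam g lam n ∧
      (n : ℝ) / 4 ≤ p.2.1 ∧ (n : ℝ) / 4 ≤ p.2.2

lemma quarter_rpow_neg_le {g : ℕ} (hg : 2 ≤ g) {n m : ℕ} (hn : 0 < n) (hm : (n : ℝ) / 4 ≤ m) :
    (m : ℝ) ^ (-alph g) ≤ 4 * (n : ℝ) ^ (-alph g) := by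
  have hn' : (0 : ℝ) < n := by exact_mod_cast hn
  have h1 := alph_lt_one hg
  calc (m : ℝ) ^ (-alph g) ≤ ((n : ℝ) / 4) ^ (-alph g) :=
        Real.rpow_le_rpow_of_nonpos (by positivity) hm (by linarith [alph_pos g])
    _ = ((n : ℝ) / 2 / 2) ^ (-alph g) := by congr 1; ring
    _ ≤ 2 * ((n : ℝ) / 2) ^ (-alph g) := half_rpow_neg_le h1 (by positivity)
    _ ≤ 2 * (2 * (n : ℝ) ^ (-alph g)) := by
        gcongr
        exact half_rpow_neg_le h1 hn'.le
    _ = _ := by ring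

lemma sum_tripleWeight_le {g : ℕ} (hg : 2 ≤ g) {lam : ℝ} {n : ℕ} (hn : 0 < n)
    {A : Finset (ℕ × ℕ × ℕ)} (hA : A ⊆ orderedTriples g lam n) (S : Finset ℕ) (E : ℕ → Finset ℕ)
    (K : ℕ) (hK : ∀ s, (E s).card ≤ K) (hS : ∀ p ∈ A, p.1 ∈ S) (hE : ∀ p ∈ A, p.2.1 ∈ E p.1) :
    ∑ p ∈ A, tripleWeight g p ≤
      16 * (n : ℝ) ^ (-2 * alph g) * K * ∑ s ∈ S, (s : ℝ) ^ (-alph g) := by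
  have hn' : (0 : ℝ) < n := by exact_mod_cast hn
  set B := 16 * (n : ℝ) ^ (-2 * alph g) with hB
  have hB₀ : 0 ≤ B := by positivity
  have hmem : ∀ p ∈ A, p.1 + p.2.1 + p.2.2 = n ∧ (n : ℝ) / 4 ≤ p.2.1 ∧ (n : ℝ) / 4 ≤ p.2.2 := by
    intro p hp
    have := (Finset.mem_filter.1 (hA hp)).2
    tauto
  have hle : ∀ p ∈ A, tripleWeight g p ≤ (fun q : (_ : ℕ) × ℕ => (q.1 : ℝ) ^ (-alph g) * B)
      ⟨p.1, p.2.1⟩ := by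
    intro p hp
    obtain ⟨-, h1, h2⟩ := hmem p hp
    have hBeq : B = (4 * (n : ℝ) ^ (-alph g)) * (4 * (n : ℝ) ^ (-alph g)) := by
      rw [hB, show -2 * alph g = -alph g + -alph g by ring, Real.rpow_add hn']
      ring
    simp only [tripleWeight]
    rw [hBeq, mul_assoc]
    gcongr
    · exact quarter_rpow_neg_le hg hn h1
    · exact quarter_rpow_neg_le hg hn h2
  have hinj : Set.InjOn (fun p : ℕ × ℕ × ℕ => (⟨p.1, p.2.1⟩ : (_ : ℕ) × ℕ)) A := by
    rintro ⟨a, b, c⟩ hp ⟨a', b', c'⟩ hp' h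
    have h1 : a = a' := congrArg (·.1) h
    have h2 : b = b' := congrArg (·.2) h
    have h3 : a + b + c = n := (hmem _ hp).1
    have h4 : a' + b' + c' = n := (hmem _ hp').1
    have : c = c' := by omega
    rw [h1, h2, this]
  calc _ ≤ ∑ p ∈ A, (fun q : (_ : ℕ) × ℕ => (q.1 : ℝ) ^ (-alph g) * B) ⟨p.1, p.2.1⟩ :=
        Finset.sum_le_sum hle
    _ = ∑ q ∈ A.image fun p : ℕ × ℕ × ℕ => (⟨p.1, p.2.1⟩ : (_ : ℕ) × ℕ),
        (q.1 : ℝ) ^ (-alph g) * B := (Finset.sum_image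
          (f := fun q : (_ : ℕ) × ℕ => (q.1 : ℝ) ^ (-alph g) * B) hinj).symm
    _ ≤ ∑ q ∈ S.sigma E, (q.1 : ℝ) ^ (-alph g) * B := by
        refine Finset.sum_le_sum_of_subset_of_nonneg ?_ fun _ _ _ => by positivity
        intro q hq
        obtain ⟨p, hp, rfl⟩ := Finset.mem_image.1 hq
        exact Finset.mem_sigma.2 ⟨hS p hp, hE p hp⟩
    _ = ∑ s ∈ S, ∑ b ∈ E s, (s : ℝ) ^ (-alph g) * B := by rw [Finset.sum_sigma]
    _ ≤ ∑ s ∈ S, K * ((s : ℝ) ^ (-alph g) * B) := by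
        refine Finset.sum_le_sum fun s _ => ?_
        rw [Finset.sum_const, nsmul_eq_mul]
        gcongr
        exact hK s
    _ = _ := by rw [← Finset.mul_sum, ← Finset.sum_mul]; ring

lemma glam_nonneg {g : ℕ} {lam : ℝ} (hlam : 1 < lam) (n : ℕ) : 0 ≤ glam g lam n := by
  have := Real.log_natCast_nonneg n
  unfold glam
  positivity

lemma glam_rpow {g : ℕ} (hg : 2 ≤ g) {lam : ℝ} (hlam : 1 < lam) (n : ℕ) :
    glam g lam n ^ (1 - alph g) =
      lam ^ (2 * (g : ℝ) + 5) * (n : ℝ) ^ (1 / (2 * (g : ℝ) + 1)) * Real.log n := by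
  have hlog := Real.log_natCast_nonneg n
  have hg' : (0 : ℝ) < g := by exact_mod_cast (by omega : 0 < g)
  have h1 : 1 - alph g ≠ 0 := by linarith [alph_lt_one hg]
  unfold glam
  rw [Real.mul_rpow (by positivity) (by positivity), Real.mul_rpow (by positivity) (by positivity),
    ← Real.rpow_mul (by positivity), ← Real.rpow_mul (by positivity), ← Real.rpow_mul hlog,
    div_mul_cancel₀ _ h1, div_mul_cancel₀ _ h1, Real.rpow_one]
  congr 3
  rw [one_sub_alph]
  field_simp

lemma sum_smallRange_le {g : ℕ} (hg : 2 ≤ g) {lam : ℝ} (hlam : 1 < lam) (n : ℕ) :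
    ∑ s ∈ Finset.Icc 1 ⌊glam g lam n⌋₊, (s : ℝ) ^ (-alph g) ≤
      (1 - alph g)⁻¹ * (lam ^ (2 * (g : ℝ) + 5) * (n : ℝ) ^ (1 / (2 * (g : ℝ) + 1)) *
        Real.log n) := by
  have h1 := alph_lt_one hg
  have h2 : 0 < 1 - alph g := by linarith
  refine (sum_Icc_rpow_neg_le (alph_pos g) h1 _).trans ?_
  rw [← glam_rpow hg hlam]
  gcongr
  exact Nat.floor_le (glam_nonneg hlam n)

lemma mem_smallRange {g : ℕ} {lam : ℝ} {n : ℕ} {p : ℕ × ℕ × ℕ}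
    (hp : p ∈ orderedTriples g lam n) : p.1 ∈ Finset.Icc 1 ⌊glam g lam n⌋₊ := by
  simp only [orderedTriples, Finset.mem_filter, Finset.mem_product, Finset.mem_Icc] at hp ⊢
  exact ⟨hp.1.1.1, Nat.le_floor hp.2.2.2.1⟩

lemma sum_orderedTriples_le {g : ℕ} (hg : 2 ≤ g) {lam : ℝ} (hlam : 1 < lam) {n : ℕ} (hn : 0 < n) :
    ∑ p ∈ orderedTriples g lam n, tripleWeight g p ≤
      16 * (1 - alph g)⁻¹ * lam ^ (2 * (g : ℝ) + 5) * Real.log n := by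
  have hn' : (0 : ℝ) < n := by exact_mod_cast hn
  refine (sum_tripleWeight_le hg hn (Finset.Subset.refl _) _ (fun _ => Finset.Icc 1 n) n
    (fun _ => by simp) (fun p hp => mem_smallRange hp) (fun p hp => ?_)).trans ?_
  · simp only [orderedTriples, Finset.mem_filter, Finset.mem_product] at hp
    exact hp.1.2.1
  · calc _ ≤ 16 * (n : ℝ) ^ (-2 * alph g) * n * ((1 - alph g)⁻¹ * (lam ^ (2 * (g : ℝ) + 5) *
          (n : ℝ) ^ (1 / (2 * (g : ℝ) + 1)) * Real.log n)) := by
          gcongr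
          exact sum_smallRange_le hg hlam n
      _ = 16 * (1 - alph g)⁻¹ * lam ^ (2 * (g : ℝ) + 5) * Real.log n *
          ((n : ℝ) ^ (-2 * alph g) * n * (n : ℝ) ^ (1 / (2 * (g : ℝ) + 1))) := by ring
      _ = _ := by
          rw [← Real.rpow_add_one hn'.ne', ← Real.rpow_add hn',
            show -2 * alph g + 1 + 1 / (2 * (g : ℝ) + 1) = 0 by
              linarith [one_sub_two_mul_alph g], Real.rpow_zero, mul_one]

def HasTripleQuad (r : Finset ℕ) (p : ℕ × ℕ × ℕ) : Prop :=
  ∃ w, IsAddQuad w ∧ (∀ y ∈ w, y = p.1 ∨ y = p.2.1 ∨ y = p.2.2 ∨ y ∈ r) ∧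
    ∃ y ∈ w, y = p.1 ∨ y = p.2.1 ∨ y = p.2.2

def firstValues (r : Finset ℕ) (n : ℕ) : Finset ℕ :=
  tripleImage r (fun p q s => p + q - s) ∪ tripleImage r (fun p _ _ => (n - p) / 2) ∪
    tripleImage r fun p q _ => n - p - q

def secondValues (r : Finset ℕ) (n s : ℕ) : Finset ℕ :=
  tripleImage (insert s r) (fun p q u => p + q - u) ∪
    tripleImage (insert s r) (fun p q _ => (n - s + p - q) / 2) ∪
    tripleImage (insert s r) fun p q u => n - s - (p + q - u)

lemma card_union_three_le {A B C : Finset ℕ} {K : ℕ} (hA : A.card ≤ K) (hB : B.card ≤ K)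
    (hC : C.card ≤ K) : (A ∪ B ∪ C).card ≤ 3 * K := by
  have h1 := Finset.card_union_le (A ∪ B) C
  have h2 := Finset.card_union_le A B
  omega

lemma card_firstValues_le {r : Finset ℕ} {K : ℕ} (hr : r.card ≤ K) (n : ℕ) :
    (firstValues r n).card ≤ 3 * K ^ 3 :=
  card_union_three_le (card_tripleImage_le hr _) (card_tripleImage_le hr _)
    (card_tripleImage_le hr _)

lemma card_secondValues_le {r : Finset ℕ} {K : ℕ} (hr : r.card ≤ K) (n s : ℕ) :
    (secondValues r n s).card ≤ 3 * (K + 1) ^ 3 := by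
  have h : (insert s r).card ≤ K + 1 := (Finset.card_insert_le _ _).trans (by omega)
  exact card_union_three_le (card_tripleImage_le h _) (card_tripleImage_le h _)
    (card_tripleImage_le h _)

lemma HasTripleQuad.mem_values {r : Finset ℕ} {n s b c : ℕ} (hn : s + b + c = n)
    (h : HasTripleQuad r (s, b, c)) : s ∈ firstValues r n ∨ b ∈ secondValues r n s := by
  obtain ⟨w, hw, hsub, hex⟩ := h
  simp only at hsub hex
  have hr : ∀ y ∈ w, y ≠ s → y ≠ b → y ≠ c → y ∈ r := by
    intro y hy h1 h2 h3
    rcases hsub y hy with h | h | h | h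
    · exact absurd h h1
    · exact absurd h h2
    · exact absurd h h3
    · exact h
  have hQ : ∀ y ∈ w, y ≠ b → y ≠ c → y ∈ insert s r := by
    intro y hy h2 h3
    rw [Finset.mem_insert]
    by_cases h1 : y = s
    · exact Or.inl h1
    · exact Or.inr (hr y hy h1 h2 h3)
  simp only [firstValues, secondValues, Finset.mem_union]
  by_cases hb : b ∈ w
  · obtain ⟨q, t, u, hwe, hsum⟩ := hw.exists_of_mem hb
    obtain ⟨hbq, hbt, hbu, hqt, hqu, htu⟩ := pairwise_ne_of_card_eq_four (hwe ▸ hw.1)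
    have hq : q ∈ w := by simp [hwe]
    have ht : t ∈ w := by simp [hwe]
    have hu : u ∈ w := by simp [hwe]
    clear hex hsub hw hwe
    by_cases h1 : q = c
    · left
      have ht' := hr t ht
      have hu' := hr u hu
      by_cases h2 : t = s
      · have := hu' (by omega) hbu.symm (by omega)
        exact Or.inl (Or.inr (mem_tripleImage this this this (by omega)))
      have ht'' := ht' h2 hbt.symm (by omega)
      by_cases h3 : u = s
      · exact Or.inl (Or.inr (mem_tripleImage ht'' ht'' ht'' (by omega)))
      · have := hu' h3 hbu.symm (by omega)
        exact Or.inr (mem_tripleImage ht'' this this (by omega))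
    · right
      have hq' := hQ q hq hbq.symm h1
      by_cases h2 : t = c
      · have := hQ u hu hbu.symm (by omega)
        exact Or.inl (Or.inr (mem_tripleImage this hq' hq' (by omega)))
      have ht' := hQ t ht hbt.symm h2
      by_cases h3 : u = c
      · exact Or.inl (Or.inr (mem_tripleImage ht' hq' hq' (by omega)))
      · have hu' := hQ u hu hbu.symm h3
        exact Or.inl (Or.inl (mem_tripleImage ht' hu' hq' (by omega)))
  have hnb : ∀ y ∈ w, y ≠ b := by
    rintro y hy rfl
    exact hb hy
  by_cases hc : c ∈ w
  · obtain ⟨q, t, u, hwe, hsum⟩ := hw.exists_of_mem hc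
    obtain ⟨hcq, hct, hcu, -⟩ := pairwise_ne_of_card_eq_four (hwe ▸ hw.1)
    have hQ' : ∀ y ∈ w, c ≠ y → y ∈ insert s r := fun y hy h => hQ y hy (hnb y hy) h.symm
    exact Or.inr (Or.inr (mem_tripleImage (hQ' t (by simp [hwe]) hct) (hQ' u (by simp [hwe]) hcu)
      (hQ' q (by simp [hwe]) hcq) (by omega)))
  have hnc : ∀ y ∈ w, y ≠ c := by
    rintro y hy rfl
    exact hc hy
  obtain ⟨y, hy, h⟩ := hex
  obtain rfl : y = s := by
    rcases h with h | h | h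
    · exact h
    · exact absurd h (hnb y hy)
    · exact absurd h (hnc y hy)
  obtain ⟨q, t, u, hwe, hsum⟩ := hw.exists_of_mem hy
  obtain ⟨hcq, hct, hcu, -⟩ := pairwise_ne_of_card_eq_four (hwe ▸ hw.1)
  have hr' : ∀ x ∈ w, y ≠ x → x ∈ r := fun x hx h => hr x hx h.symm (hnb x hx) (hnc x hx)
  exact Or.inl (Or.inl (Or.inl (mem_tripleImage (hr' t (by simp [hwe]) hct)
    (hr' u (by simp [hwe]) hcu) (hr' q (by simp [hwe]) hcq) (by omega))))

lemma sum_hasTripleQuad_le {g : ℕ} (hg : 2 ≤ g) {lam : ℝ} (hlam : 1 < lam) {n : ℕ} (hn : 0 < n)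
    {r : Finset ℕ} {K : ℕ} (hr : r.card ≤ K) {A : Finset (ℕ × ℕ × ℕ)}
    (hA : A ⊆ orderedTriples g lam n) (hAr : ∀ p ∈ A, HasTripleQuad r p) :
    ∑ p ∈ A, tripleWeight g p ≤
      48 * (K + 1 : ℕ) ^ 3 * (1 + (1 - alph g)⁻¹ * lam ^ (2 * (g : ℝ) + 5) * Real.log n) *
        (n : ℝ) ^ (-(1 / (2 * (g : ℝ) + 1))) := by
  have hn1 : (1 : ℝ) ≤ n := by exact_mod_cast hn
  have hn' : (0 : ℝ) < n := by linarith
  have hlog := Real.log_natCast_nonneg n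
  have h2 : 0 < 1 - alph g := by linarith [alph_lt_one hg]
  classical
  set A₁ := A.filter fun p => p.1 ∈ firstValues r n with hA₁
  set A₂ := A.filter fun p => p.2.1 ∈ secondValues r n p.1 with hA₂
  have hunion : A ⊆ A₁ ∪ A₂ := by
    rintro ⟨s, b, c⟩ hp
    have hsum : s + b + c = n := (Finset.mem_filter.1 (hA hp)).2.1
    rw [Finset.mem_union, hA₁, hA₂, Finset.mem_filter, Finset.mem_filter]
    exact ((hAr _ hp).mem_values hsum).imp (fun h => ⟨hp, h⟩) (fun h => ⟨hp, h⟩)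
  have hsplit : ∑ p ∈ A, tripleWeight g p ≤
      ∑ p ∈ A₁, tripleWeight g p + ∑ p ∈ A₂, tripleWeight g p := by
    refine (Finset.sum_le_sum_of_subset_of_nonneg hunion
      fun _ _ _ => tripleWeight_nonneg _ _).trans ?_
    rw [← Finset.sum_union_inter]
    exact le_add_of_nonneg_right (Finset.sum_nonneg fun _ _ => tripleWeight_nonneg _ _)
  have hs₁ : A₁ ⊆ orderedTriples g lam n := (Finset.filter_subset _ _).trans hA
  have hs₂ : A₂ ⊆ orderedTriples g lam n := (Finset.filter_subset _ _).trans hA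
  have hb₁ : ∑ p ∈ A₁, tripleWeight g p ≤
      16 * (n : ℝ) ^ (-2 * alph g) * n * (3 * (K + 1 : ℕ) ^ 3) := by
    refine (sum_tripleWeight_le hg hn hs₁ ((firstValues r n).filter (1 ≤ ·))
      (fun _ => Finset.Icc 1 n) n (fun _ => by simp) (fun p hp => ?_) (fun p hp => ?_)).trans ?_
    · have h := hs₁ hp
      simp only [orderedTriples, Finset.mem_filter, Finset.mem_product, Finset.mem_Icc] at h
      exact Finset.mem_filter.2 ⟨(Finset.mem_filter.1 hp).2, h.1.1.1⟩
    · have h := hs₁ hp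
      simp only [orderedTriples, Finset.mem_filter, Finset.mem_product] at h
      exact h.1.2.1
    · gcongr
      calc _ ≤ ∑ s ∈ (firstValues r n).filter (1 ≤ ·), (1 : ℝ) := by
            refine Finset.sum_le_sum fun s hs => ?_
            refine Real.rpow_le_one_of_one_le_of_nonpos ?_ (by linarith [alph_pos g])
            exact_mod_cast (Finset.mem_filter.1 hs).2
        _ ≤ ((3 * (K + 1) ^ 3 : ℕ) : ℝ) := by
            rw [Finset.sum_const, nsmul_eq_mul, mul_one]
            refine Nat.cast_le.2 ((Finset.card_filter_le _ _).trans ?_)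
            refine (card_firstValues_le hr n).trans ?_
            gcongr
            omega
        _ = _ := by push_cast; ring
  have hb₂ : ∑ p ∈ A₂, tripleWeight g p ≤
      16 * (n : ℝ) ^ (-2 * alph g) * (3 * (K + 1) ^ 3 : ℕ) * ((1 - alph g)⁻¹ *
        (lam ^ (2 * (g : ℝ) + 5) * (n : ℝ) ^ (1 / (2 * (g : ℝ) + 1)) * Real.log n)) := by
    refine (sum_tripleWeight_le hg hn hs₂ _ (secondValues r n) _ (card_secondValues_le hr n)
      (fun p hp => mem_smallRange (hs₂ hp)) (fun p hp => (Finset.mem_filter.1 hp).2)).trans ?_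
    gcongr
    exact sum_smallRange_le hg hlam n
  have he₁ : (n : ℝ) ^ (-2 * alph g) * n = (n : ℝ) ^ (-(1 / (2 * (g : ℝ) + 1))) := by
    rw [← Real.rpow_add_one hn'.ne', ← one_sub_two_mul_alph]
    congr 1
    ring
  have he₂ : (n : ℝ) ^ (-2 * alph g) * (n : ℝ) ^ (1 / (2 * (g : ℝ) + 1)) ≤
      (n : ℝ) ^ (-(1 / (2 * (g : ℝ) + 1))) := by
    rw [← Real.rpow_add hn']
    refine Real.rpow_le_rpow_of_exponent_le hn1 ?_
    have h3 := one_sub_two_mul_alph g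
    have h4 : 1 / (2 * (g : ℝ) + 1) ≤ 1 := by
      rw [div_le_one (by positivity)]
      linarith [g.cast_nonneg (α := ℝ)]
    linarith
  have hLnn : 0 ≤ (1 - alph g)⁻¹ * lam ^ (2 * (g : ℝ) + 5) * Real.log n := by positivity
  calc _ ≤ _ := hsplit.trans (add_le_add hb₁ hb₂)
    _ = 48 * (K + 1 : ℕ) ^ 3 * ((n : ℝ) ^ (-2 * alph g) * n) +
        48 * (K + 1 : ℕ) ^ 3 * ((1 - alph g)⁻¹ * lam ^ (2 * (g : ℝ) + 5) * Real.log n) *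
          ((n : ℝ) ^ (-2 * alph g) * (n : ℝ) ^ (1 / (2 * (g : ℝ) + 1))) := by push_cast; ring
    _ ≤ 48 * (K + 1 : ℕ) ^ 3 * (n : ℝ) ^ (-(1 / (2 * (g : ℝ) + 1))) +
        48 * (K + 1 : ℕ) ^ 3 * ((1 - alph g)⁻¹ * lam ^ (2 * (g : ℝ) + 5) * Real.log n) *
          (n : ℝ) ^ (-(1 / (2 * (g : ℝ) + 1))) := by
        rw [he₁]
        gcongr
    _ = _ := by ring

def tailOf (g : ℕ) (x : Fin (2 * g + 4) → ℕ) : Fin (2 * g + 1) → ℕ :=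
  fun i => x ⟨i + 3, by omega⟩

def headTriple (g : ℕ) (x : Fin (2 * g + 4) → ℕ) : ℕ × ℕ × ℕ :=
  (x ⟨0, by omega⟩, x ⟨1, by omega⟩, x ⟨2, by omega⟩)

lemma prod_rpow_eq (g : ℕ) (x : Fin (2 * g + 4) → ℕ) :
    ∏ i, (x i : ℝ) ^ (-alph g) =
      tripleWeight g (headTriple g x) * tailWeight g (tailOf g x) := by
  rw [Fin.prod_univ_succ, Fin.prod_univ_succ, Fin.prod_univ_succ, ← mul_assoc, ← mul_assoc]
  rfl

lemma mem_imgF_cases {g : ℕ} {x : Fin (2 * g + 4) → ℕ} {y : ℕ} (hy : y ∈ imgF x) :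
    y = (headTriple g x).1 ∨ y = (headTriple g x).2.1 ∨ y = (headTriple g x).2.2 ∨
      y ∈ imgF (tailOf g x) := by
  obtain ⟨⟨i, hi⟩, rfl⟩ := mem_imgF_iff.1 hy
  rcases i with _ | _ | _ | i
  · exact Or.inl rfl
  · exact Or.inr (Or.inl rfl)
  · exact Or.inr (Or.inr (Or.inl rfl))
  · exact Or.inr (Or.inr (Or.inr (mem_imgF_iff.2 ⟨⟨i, by omega⟩, rfl⟩)))

lemma eq_of_headTriple_eq_of_tailOf_eq {g : ℕ} {x y : Fin (2 * g + 4) → ℕ}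
    (h : headTriple g x = headTriple g y) (h' : tailOf g x = tailOf g y) : x = y := by
  funext ⟨i, hi⟩
  simp only [headTriple, Prod.mk.injEq] at h
  rcases i with _ | _ | _ | i
  · exact h.1
  · exact h.2.1
  · exact h.2.2
  · exact congrFun h' ⟨i, by omega⟩

lemma tailOf_mem_Vr {g M : ℕ} {lam : ℝ} {s : ℕ → Fin 3 → ZMod M} {n : ℕ}
    {x : Fin (2 * g + 4) → ℕ} (hx : x ∈ TnInd g M lam s n) :
    tailOf g x ∈ Vr g (headTriple g x).1 := by
  obtain ⟨⟨hpos, -, hsum, hle, -, -⟩, hinj⟩ := hx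
  refine ⟨fun i => hpos _, fun t ht => ?_, fun i => hle _ (by simp), fun i j h => ?_, fun i h => ?_⟩
  · exact hsum (t + 2) (by omega) (by omega)
  · have := Fin.mk.inj_iff.1 (hinj h)
    exact Fin.ext (by omega)
  · have := Fin.mk.inj_iff.1 (hinj h)
    omega

lemma SxV_tailOf_subset (g : ℕ) (x : Fin (2 * g + 4) → ℕ) :
    SxV g (headTriple g x).1 (tailOf g x) ⊆ Sx g x := by
  have h1 : ∀ l, 3 ≤ l → 2 * l - 5 + 3 = 2 * l - 2 := by omega
  have h2 : ∀ l, 3 ≤ l → 2 * l - 4 + 3 = 2 * l - 1 := by omega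
  rintro w (⟨l, hl, hlg, rfl⟩ | ⟨l, j, hl, hlj, hjg, rfl⟩)
  · refine Or.inl ⟨l, hl, hlg, ?_⟩
    simp only [tailOf, headTriple, h1 l hl, h2 l hl, zero_add]
  · refine Or.inr ⟨l, j, hl, hlj, hjg, ?_⟩
    simp only [tailOf, h1 l hl, h2 l hl, h1 j (by omega), h2 j (by omega)]

lemma isDegenerate_or_hasTripleQuad {g M : ℕ} {lam : ℝ} {s : ℕ → Fin 3 → ZMod M} {n : ℕ}
    {x : Fin (2 * g + 4) → ℕ} (hx : x ∈ TnInd g M lam s n) {r w : Finset ℕ}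
    (hw : w ∈ Ccal (imgF x ∪ r) (imgF x) r) (hwS : w ∉ Sx g x) :
    IsDegenerate g (headTriple g x).1 (r ∪ {(headTriple g x).2.1, (headTriple g x).2.2})
      (tailOf g x) ∨ HasTripleQuad r (headTriple g x) := by
  by_cases htail : ∃ y ∈ w, y ∈ imgF (tailOf g x) ∧ y ∉ r
  · left
    obtain ⟨y, hy, hyt, hyr⟩ := htail
    refine Vr.head_or_solved (tailOf_mem_Vr hx) (w := w) ⟨hw.1, fun a ha => ?_, ?_, hw.2.2.2⟩
      fun h => hwS (SxV_tailOf_subset g x h)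
    · simp only [Finset.mem_union, Finset.mem_insert, Finset.mem_singleton]
      rcases Finset.mem_union.1 (hw.2.1 ha) with h | h
      · rcases mem_imgF_cases h with h | h | h | h
        · exact Or.inr h
        · exact Or.inl (Or.inr (Or.inr (Or.inl h)))
        · exact Or.inl (Or.inr (Or.inr (Or.inr h)))
        · exact Or.inl (Or.inl h)
      · exact Or.inl (Or.inr (Or.inl h))
    · refine ⟨y, hy, hyt, ?_⟩
      obtain ⟨i, rfl⟩ := mem_imgF_iff.1 hyt
      simp only [Finset.mem_union, Finset.mem_insert, Finset.mem_singleton, not_or]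
      refine ⟨hyr, fun h => ?_, fun h => ?_⟩
      · have := Fin.mk.inj_iff.1 (hx.2 h)
        omega
      · have := Fin.mk.inj_iff.1 (hx.2 h)
        omega
  · right
    push Not at htail
    refine ⟨w, Ccal.isAddQuad hw, fun y hy => ?_, ?_⟩
    · rcases Finset.mem_union.1 (hw.2.1 hy) with h | h
      · exact (mem_imgF_cases h).imp_right <| Or.imp_right <| Or.imp_right <| htail y hy
      · exact Or.inr (Or.inr (Or.inr h))
    · obtain ⟨y, hy, hyx, hyr⟩ := hw.2.2.1
      refine ⟨y, hy, ?_⟩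
      rcases mem_imgF_cases hyx with h | h | h | h
      · exact Or.inl h
      · exact Or.inr (Or.inl h)
      · exact Or.inr (Or.inr h)
      · exact absurd (htail y hy h) hyr

def rotations (A : Finset (ℕ × ℕ × ℕ)) : Finset (ℕ × ℕ × ℕ) :=
  A ∪ A.image (fun p => (p.2.1, p.1, p.2.2)) ∪ A.image fun p => (p.2.1, p.2.2, p.1)

lemma sum_rotations_le (A : Finset (ℕ × ℕ × ℕ)) (f : ℕ × ℕ × ℕ → ℝ) (hf : ∀ p, 0 ≤ f p)
    (h₁ : ∀ a b c, f (b, a, c) = f (a, b, c)) (h₂ : ∀ a b c, f (b, c, a) = f (a, b, c)) :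
    ∑ p ∈ rotations A, f p ≤ 3 * ∑ p ∈ A, f p := by
  have hun : ∀ B D : Finset (ℕ × ℕ × ℕ), ∑ p ∈ B ∪ D, f p ≤ ∑ p ∈ B, f p + ∑ p ∈ D, f p := by
    intro B D
    rw [← Finset.sum_union_inter]
    exact le_add_of_nonneg_right (Finset.sum_nonneg fun _ _ => hf _)
  have e₁ : ∑ p ∈ A.image (fun p => (p.2.1, p.1, p.2.2)), f p = ∑ p ∈ A, f p := by
    rw [Finset.sum_image]
    · exact Finset.sum_congr rfl fun p _ => h₁ _ _ _
    · rintro ⟨a, b, c⟩ - ⟨a', b', c'⟩ - h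
      simp_all
  have e₂ : ∑ p ∈ A.image (fun p => (p.2.1, p.2.2, p.1)), f p = ∑ p ∈ A, f p := by
    rw [Finset.sum_image]
    · exact Finset.sum_congr rfl fun p _ => h₂ _ _ _
    · rintro ⟨a, b, c⟩ - ⟨a', b', c'⟩ - h
      simp_all
  have := hun (A ∪ A.image (fun p => (p.2.1, p.1, p.2.2))) (A.image fun p => (p.2.1, p.2.2, p.1))
  have := hun A (A.image (fun p => (p.2.1, p.1, p.2.2)))
  unfold rotations
  linarith

lemma Rtrip.mem_orderedTriples {g M : ℕ} {lam : ℝ} {s : ℕ → Fin 3 → ZMod M} {n a b c : ℕ}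
    (h : Rtrip g M lam s n a b c) {q u : ℕ} (hqa : q ≠ a) (hua : u ≠ a) (hqu : q ≠ u)
    (hq : q ∈ ({a, b, c} : Finset ℕ)) (hu : u ∈ ({a, b, c} : Finset ℕ)) :
    (a, q, u) ∈ orderedTriples g lam n := by
  obtain ⟨h1, h2, h3, h4, h5, h6, h7, -, h8, -⟩ := h
  simp only [Finset.mem_insert, Finset.mem_singleton, hqa, hua, false_or] at hq hu
  simp only [orderedTriples, Finset.mem_filter, Finset.mem_product, Finset.mem_Icc]
  rcases hq with rfl | rfl <;> rcases hu with rfl | rfl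
  · exact absurd rfl hqu
  · exact ⟨by omega, h4, h5, h6, h7, h8⟩
  · exact ⟨by omega, by omega, h5, h6, h8, h7⟩
  · exact absurd rfl hqu

lemma headTriple_mem {g M : ℕ} {lam : ℝ} {s : ℕ → Fin 3 → ZMod M} {n : ℕ}
    {x : Fin (2 * g + 4) → ℕ} (hx : x ∈ TnInd g M lam s n) :
    headTriple g x ∈ rotations (orderedTriples g lam n) := by
  obtain ⟨⟨-, ⟨a, b, c, h, hR⟩, -⟩, hinj⟩ := hx
  have h01 : x ⟨0, by omega⟩ ≠ x ⟨1, by omega⟩ := fun h => by simpa using hinj h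
  have h02 : x ⟨0, by omega⟩ ≠ x ⟨2, by omega⟩ := fun h => by simpa using hinj h
  have h12 : x ⟨1, by omega⟩ ≠ x ⟨2, by omega⟩ := fun h => by simpa using hinj h
  unfold firstThree at h
  have m0 : x ⟨0, by omega⟩ ∈ ({a, b, c} : Finset ℕ) := by simp [← h]
  have m1 : x ⟨1, by omega⟩ ∈ ({a, b, c} : Finset ℕ) := by simp [← h]
  have m2 : x ⟨2, by omega⟩ ∈ ({a, b, c} : Finset ℕ) := by simp [← h]
  have ha : a ∈ ({x ⟨0, by omega⟩, x ⟨1, by omega⟩, x ⟨2, by omega⟩} : Finset ℕ) := by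
    rw [h]
    exact Finset.mem_insert_self _ _
  simp only [Finset.mem_insert, Finset.mem_singleton] at ha
  simp only [rotations, Finset.mem_union, Finset.mem_image]
  rcases ha with ha | ha | ha <;> rw [ha] at hR m0 m1 m2
  · exact Or.inl (Or.inl (hR.mem_orderedTriples h01.symm h02.symm h12 m1 m2))
  · exact Or.inl (Or.inr ⟨_, hR.mem_orderedTriples h01 h12.symm h02 m0 m2, rfl⟩)
  · exact Or.inr ⟨_, hR.mem_orderedTriples h02 h12 h01 m0 m1, rfl⟩

lemma le_of_mem_rotations {g : ℕ} {lam : ℝ} {n : ℕ} {p : ℕ × ℕ × ℕ}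
    (hp : p ∈ rotations (orderedTriples g lam n)) : p.1 ≤ n ∧ p.2.1 ≤ n ∧ p.2.2 ≤ n := by
  simp only [rotations, orderedTriples, Finset.mem_union, Finset.mem_image, Finset.mem_filter,
    Finset.mem_product, Finset.mem_Icc] at hp
  rcases hp with (h | ⟨q, h, rfl⟩) | ⟨q, h, rfl⟩ <;> (try dsimp only) <;>
    exact ⟨by omega, by omega, by omega⟩

lemma TnInd_finite (g M : ℕ) (lam : ℝ) (s : ℕ → Fin 3 → ZMod M) (n : ℕ) :
    (TnInd g M lam s n).Finite := by
  refine (Set.finite_Icc (0 : Fin (2 * g + 4) → ℕ) fun _ => n).subset fun x hx =>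
    ⟨fun _ => Nat.zero_le _, fun i => ?_⟩
  obtain ⟨h0, h1, h2⟩ := le_of_mem_rotations (headTriple_mem hx)
  rcases mem_imgF_cases (mem_imgF_iff.2 ⟨i, rfl⟩) with h | h | h | h
  · exact h.trans_le h0
  · exact h.trans_le h1
  · exact h.trans_le h2
  · obtain ⟨j, hj⟩ := mem_imgF_iff.1 h
    exact hj.symm.trans_le (((tailOf_mem_Vr hx).2.2.1 j).trans h0)

lemma rpow_le_glam_div_two {g : ℕ} (hg : 2 ≤ g) {lam : ℝ} (hlam : 1 < lam) {n : ℕ} (hn : 16 ≤ n) :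
    (n : ℝ) ^ ((1 : ℝ) / g) ≤ glam g lam n / 2 := by
  have h2 : 0 < 1 - alph g := by linarith [alph_lt_one hg]
  have hlog : 2 ≤ Real.log n := by
    calc (2 : ℝ) ≤ 4 * Real.log 2 := by linarith [Real.log_two_gt_d9]
      _ = Real.log 16 := by
        rw [show (16 : ℝ) = 2 ^ 4 by norm_num, Real.log_pow]
        norm_num
      _ ≤ Real.log n := Real.log_le_log (by norm_num) (by exact_mod_cast hn)
  have hl : 1 ≤ lam ^ ((2 * (g : ℝ) + 5) / (1 - alph g)) :=
    Real.one_le_rpow hlam.le (by positivity)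
  have hL : 2 ≤ Real.log n ^ ((1 : ℝ) / (1 - alph g)) := by
    refine hlog.trans (Real.self_le_rpow_of_one_le (by linarith) ?_)
    rw [le_div_iff₀ h2]
    linarith [alph_pos g]
  have hN : 0 ≤ (n : ℝ) ^ ((1 : ℝ) / g) := by positivity
  unfold glam
  rw [le_div_iff₀ two_pos]
  calc _ ≤ 1 * (n : ℝ) ^ ((1 : ℝ) / g) * 2 := by rw [one_mul]
    _ ≤ _ := by gcongr

lemma rpow_le_div_four {g : ℕ} (hg : 2 ≤ g) {n : ℕ} (hn : 16 ≤ n) :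
    (n : ℝ) ^ ((1 : ℝ) / g) ≤ n / 4 := by
  have hn' : (16 : ℝ) ≤ n := by exact_mod_cast hn
  have hg' : (2 : ℝ) ≤ g := by exact_mod_cast hg
  calc (n : ℝ) ^ ((1 : ℝ) / g) ≤ (n : ℝ) ^ ((1 : ℝ) / 2) := by
        refine Real.rpow_le_rpow_of_exponent_le (by linarith) ?_
        gcongr
    _ = √n := (Real.sqrt_eq_rpow _).symm
    _ ≤ n / 4 := by
        have h4 : 4 ≤ √(n : ℝ) := Real.le_sqrt_of_sq_le (by linarith)
        have hs := Real.mul_self_sqrt (by linarith : (0 : ℝ) ≤ n)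
        nlinarith

lemma rpow_le_of_mem_rotations {g : ℕ} (hg : 2 ≤ g) {lam : ℝ} (hlam : 1 < lam) {n : ℕ}
    (hn : 16 ≤ n) {p : ℕ × ℕ × ℕ} (hp : p ∈ rotations (orderedTriples g lam n)) :
    (n : ℝ) ^ ((1 : ℝ) / g) ≤ p.1 := by
  have h₁ := rpow_le_glam_div_two hg hlam hn
  have h₂ := rpow_le_div_four hg hn
  simp only [rotations, orderedTriples, Finset.mem_union, Finset.mem_image,
    Finset.mem_filter] at hp
  rcases hp with (⟨-, -, h, -⟩ | ⟨q, ⟨-, -, -, -, h, -⟩, rfl⟩) | ⟨q, ⟨-, -, -, -, h, -⟩, rfl⟩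
  · exact h₁.trans h
  · exact h₂.trans h
  · exact h₂.trans h

lemma rpow_neg_le_of_rpow_le {g : ℕ} (hg : 2 ≤ g) {n m : ℕ} (hn : 0 < n)
    (h : (n : ℝ) ^ ((1 : ℝ) / g) ≤ m) :
    (m : ℝ) ^ (-(1 - alph g)) ≤ (n : ℝ) ^ (-(1 / (2 * (g : ℝ) + 1))) := by
  have hn' : (0 : ℝ) < n := by exact_mod_cast hn
  have hg' : (0 : ℝ) < g := by exact_mod_cast (by omega : 0 < g)
  calc (m : ℝ) ^ (-(1 - alph g)) ≤ ((n : ℝ) ^ ((1 : ℝ) / g)) ^ (-(1 - alph g)) :=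
        Real.rpow_le_rpow_of_nonpos (by positivity) h (by linarith [alph_lt_one hg])
    _ = _ := by
        rw [← Real.rpow_mul hn'.le, one_sub_alph]
        congr 1
        field_simp

lemma HasTripleQuad.of_iff {r : Finset ℕ} {p q : ℕ × ℕ × ℕ}
    (h : ∀ y, (y = p.1 ∨ y = p.2.1 ∨ y = p.2.2) ↔ (y = q.1 ∨ y = q.2.1 ∨ y = q.2.2)) :
    HasTripleQuad r p ↔ HasTripleQuad r q := by
  unfold HasTripleQuad
  simp only [← or_assoc] at h ⊢
  simp only [h]

lemma sum_rotations_tripleWeight_le {g : ℕ} (A : Finset (ℕ × ℕ × ℕ)) (r : Finset ℕ) {B D : ℝ}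
    (hB : 0 ≤ B) (hD : 0 ≤ D) [DecidablePred (HasTripleQuad r)] :
    ∑ p ∈ rotations A, tripleWeight g p * (B + if HasTripleQuad r p then D else 0) ≤
      3 * (B * ∑ p ∈ A, tripleWeight g p +
        D * ∑ p ∈ A with HasTripleQuad r p, tripleWeight g p) := by
  refine (sum_rotations_le A _ (fun p => ?_) (fun a b c => ?_) (fun a b c => ?_)).trans_eq ?_
  · have := tripleWeight_nonneg g p
    split_ifs <;> positivity
  · have h : HasTripleQuad r (b, a, c) ↔ HasTripleQuad r (a, b, c) :=
      HasTripleQuad.of_iff fun y => by simp only; tauto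
    simp only [h, tripleWeight]
    ring
  · have h : HasTripleQuad r (b, c, a) ↔ HasTripleQuad r (a, b, c) :=
      HasTripleQuad.of_iff fun y => by simp only; tauto
    simp only [h, tripleWeight]
    ring
  · rw [Finset.sum_filter, Finset.mul_sum _ _ B, Finset.mul_sum _ _ D, ← Finset.sum_add_distrib]
    congr 1
    refine Finset.sum_congr rfl fun p _ => ?_
    split_ifs <;> ring

lemma sum_le_sum_rotations {g M : ℕ} {lam : ℝ} {s : ℕ → Fin 3 → ZMod M} {n : ℕ}
    {A : Finset (Fin (2 * g + 4) → ℕ)} (hA : ∀ x ∈ A, x ∈ TnInd g M lam s n)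
    (b : ℕ × ℕ × ℕ → ℝ) (hb : ∀ p ∈ rotations (orderedTriples g lam n),
      ∑ v ∈ (A.filter (headTriple g · = p)).image (tailOf g), tailWeight g v ≤ b p) :
    ∑ x ∈ A, ∏ i, (x i : ℝ) ^ (-alph g) ≤
      ∑ p ∈ rotations (orderedTriples g lam n), tripleWeight g p * b p := by
  rw [← Finset.sum_fiberwise_of_maps_to (g := headTriple g) fun x hx => headTriple_mem (hA x hx)]
  refine Finset.sum_le_sum fun p hp => ?_
  refine le_trans (le_of_eq ?_) (mul_le_mul_of_nonneg_left (hb p hp) (tripleWeight_nonneg g p))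
  have hinj : Set.InjOn (tailOf g) (A.filter (headTriple g · = p)) := by
    intro x hx y hy h
    have hx' := (Finset.mem_filter.1 hx).2
    have hy' := (Finset.mem_filter.1 hy).2
    exact eq_of_headTriple_eq_of_tailOf_eq (hx'.trans hy'.symm) h
  rw [Finset.sum_image hinj, Finset.mul_sum]
  refine Finset.sum_congr rfl fun x hx => ?_
  rw [prod_rpow_eq, (Finset.mem_filter.1 hx).2]

lemma exists_sum_exceptional_le {g : ℕ} (hg : 2 ≤ g) :
    ∃ C : ℝ, 0 < C ∧ ∀ (M : ℕ) (lam : ℝ) (s : ℕ → Fin 3 → ZMod M) (n : ℕ),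
      1 < lam → 16 ≤ n → ∀ r : Finset ℕ, r.card ≤ 2 * g + 4 →
      ∀ A : Finset (Fin (2 * g + 4) → ℕ), (∀ x ∈ A, x ∈ TnInd g M lam s n) →
      (∀ x ∈ A, IsDegenerate g (headTriple g x).1
          (r ∪ {(headTriple g x).2.1, (headTriple g x).2.2}) (tailOf g x) ∨
        HasTripleQuad r (headTriple g x)) →
      ∑ x ∈ A, ∏ i, (x i : ℝ) ^ (-alph g) ≤
        C * (1 + (1 - alph g)⁻¹ * lam ^ (2 * (g : ℝ) + 5) * Real.log n) *
          (n : ℝ) ^ (-(1 / (2 * (g : ℝ) + 1))) := by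
  classical
  have hα : 0 < 1 - alph g := by linarith [alph_lt_one hg]
  obtain ⟨C, hC, hdeg⟩ := exists_sum_tailWeight_degenerate_le hg (2 * g + 6)
  set D : ℝ := (1 - alph g)⁻¹ * (4 * (1 - alph g)⁻¹) ^ g with hDdef
  have hD : 0 < D := by positivity
  refine ⟨48 * C + 144 * (2 * g + 4 + 1 : ℕ) ^ 3 * D, by positivity, ?_⟩
  intro M lam s n hlam hn r hr A hA hbad
  have hn₀ : 0 < n := by omega
  have hlog := Real.log_natCast_nonneg n
  set N : ℝ := (n : ℝ) ^ (-(1 / (2 * (g : ℝ) + 1))) with hN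
  set L : ℝ := (1 - alph g)⁻¹ * lam ^ (2 * (g : ℝ) + 5) * Real.log n with hL
  have hN₀ : 0 ≤ N := by positivity
  have hL₀ : 0 ≤ L := by positivity
  refine (sum_le_sum_rotations hA (fun p => C * N + if HasTripleQuad r p then D else 0)
    fun p hp => ?_).trans ?_
  · have hpn := rpow_le_of_mem_rotations hg hlam hn hp
    have hp₀ : 0 < p.1 := by
      have : (0 : ℝ) < p.1 := lt_of_lt_of_le (by positivity) hpn
      exact_mod_cast this
    have hV : ∀ v ∈ (A.filter (headTriple g · = p)).image (tailOf g), v ∈ Vr g p.1 := by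
      intro v hv
      obtain ⟨x, hx, rfl⟩ := Finset.mem_image.1 hv
      obtain ⟨hxA, rfl⟩ := Finset.mem_filter.1 hx
      exact tailOf_mem_Vr (hA x hxA)
    split_ifs with hq
    · exact (sum_tailWeight_le hg hp₀ hV).trans (le_add_of_nonneg_left (by positivity))
    · rw [add_zero]
      refine (hdeg p.1 hp₀ (r ∪ {p.2.1, p.2.2}) ?_ _ hV fun v hv => ?_).trans ?_
      · have := Finset.card_union_le r {p.2.1, p.2.2}
        have := Finset.card_le_two (a := p.2.1) (b := p.2.2)
        omega
      · obtain ⟨x, hx, rfl⟩ := Finset.mem_image.1 hv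
        obtain ⟨hxA, rfl⟩ := Finset.mem_filter.1 hx
        exact (hbad x hxA).resolve_right hq
      · gcongr
        exact rpow_neg_le_of_rpow_le hg hn₀ hpn
  · have h₁ := sum_orderedTriples_le hg hlam hn₀
    have h₂ := sum_hasTripleQuad_le hg hlam hn₀ hr (Finset.filter_subset (HasTripleQuad r)
      (orderedTriples g lam n)) fun p hp => (Finset.mem_filter.1 hp).2
    have h₃ : ∑ p ∈ orderedTriples g lam n, tripleWeight g p ≤ 16 * (1 + L) := by
      rw [hL]
      linarith
    calc _ ≤ _ := sum_rotations_tripleWeight_le _ r (by positivity) hD.le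
      _ ≤ 3 * (C * N * (16 * (1 + L)) +
          D * (48 * (2 * g + 4 + 1 : ℕ) ^ 3 * (1 + L) * N)) := by gcongr
      _ = _ := by ring

theorem exists_tsum_TnInd_le {g : ℕ} (hg : 2 ≤ g) :
    ∃ C : ℝ, 0 < C ∧ ∀ (M : ℕ) (lam : ℝ) (s : ℕ → Fin 3 → ZMod M) (n : ℕ),
      1 < lam → 16 ≤ n → ∀ r : Finset ℕ, r.card ≤ 2 * g + 4 →
      (∑' x : ↥(TnInd g M lam s n), (∏ i : Fin (2 * g + 4), (x.1 i : ℝ) ^ (-alph g)) *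
        ((Ccal (imgF x.1 ∪ r) (imgF x.1) r \ Sx g x.1).ncard : ℝ)) ≤
      C * (1 + (1 - alph g)⁻¹ * lam ^ (2 * (g : ℝ) + 5) * Real.log n) *
        (n : ℝ) ^ (-(1 / (2 * (g : ℝ) + 1))) := by
  classical
  obtain ⟨C, hC, h⟩ := exists_sum_exceptional_le hg
  refine ⟨(2 ^ (4 * g + 8) : ℕ) * C, by positivity, fun M lam s n hlam hn r hr => ?_⟩
  refine ((TnInd_finite g M lam s n).tsum_subtype_eq_sum fun x =>
    (∏ i : Fin (2 * g + 4), (x i : ℝ) ^ (-alph g)) *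
      ((Ccal (imgF x ∪ r) (imgF x) r \ Sx g x).ncard : ℝ)).trans_le ?_
  have hmem : ∀ x ∈ (TnInd_finite g M lam s n).toFinset, x ∈ TnInd g M lam s n :=
    fun x hx => by simpa using hx
  refine (sum_mul_ncard_le _ _ (fun x => by positivity) _ (2 ^ (4 * g + 8)) (fun x => ?_)
    (fun x => IsDegenerate g (headTriple g x).1
      (r ∪ {(headTriple g x).2.1, (headTriple g x).2.2}) (tailOf g x) ∨
        HasTripleQuad r (headTriple g x)) ?_).trans ?_
  · refine ncard_Ccal_diff_le ?_
    have h1 := Finset.card_union_le (imgF x) r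
    have h2 := card_imgF_le x
    omega
  · rintro x hx ⟨w, hw, hwS⟩
    exact isDegenerate_or_hasTripleQuad (hmem x hx) hw hwS
  · rw [mul_assoc, mul_assoc, ← mul_assoc C]
    gcongr
    exact h M lam s n hlam hn r hr _ (fun x hx => hmem x (Finset.mem_filter.1 hx).1)
      fun x hx => (Finset.mem_filter.1 hx).2

lemma one_add_mul_log_mul_rpow_le {b c x : ℝ} (hb : 0 < b) (hc : 0 ≤ c) (hx : 1 ≤ x) :
    (1 + c * Real.log x) * x ^ (-b) ≤ (1 + c / (b / 2)) * x ^ (-(b / 2)) := by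
  have hx₀ : 0 < x := by linarith
  have h1 : 1 ≤ x ^ (b / 2) := Real.one_le_rpow hx (by positivity)
  have h2 := Real.log_le_rpow_div hx₀.le (half_pos hb)
  calc (1 + c * Real.log x) * x ^ (-b) ≤
        (x ^ (b / 2) + c * (x ^ (b / 2) / (b / 2))) * x ^ (-b) := by gcongr
    _ = (1 + c / (b / 2)) * (x ^ (b / 2) * x ^ (-b)) := by ring
    _ = _ := by
        rw [← Real.rpow_add hx₀]
        congr 2
        ring

theorem stmt15 (g M : ℕ) (hg : 2 ≤ g) (hM : 1 ≤ M) (CM : Set (ZMod M))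
    (hSidon : IsSidonZ CM) (hcov : Covers3 CM) :
    ∃ δ : ℝ, 0 < δ ∧
      ∀ s : ℕ → Fin 3 → ZMod M, GoodS M CM s →
      ∀ lam : ℝ, 1 < lam → ∃ C : ℝ, 0 < C ∧ ∃ n₀ : ℕ, ∀ n : ℕ, n₀ ≤ n →
      ∀ r : Finset ℕ, r.Nonempty → (∀ a ∈ r, 1 ≤ a ∧ a ≤ n) → r.card ≤ 2 * g + 4 →
        ((∑' x : ↥(TnInd g M lam s n),
            (∏ i : Fin (2 * g + 4), (x.1 i : ℝ) ^ (-alph g)) *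
              ((Ccal (imgF x.1 ∪ r) (imgF x.1) r \ Sx g x.1).ncard : ℝ))
          ≤ C * (n : ℝ) ^ (-δ)) ∧
        (∀ r₁ : ℕ, (n : ℝ) ^ ((1 : ℝ) / (g : ℝ)) ≤ (r₁ : ℝ) →
          (∑' v : ↥(Vr g r₁),
            (∏ i : Fin (2 * g + 1), (v.1 i : ℝ) ^ (-alph g)) *
              ((Ccal (imgF v.1 ∪ r ∪ {r₁}) (imgF v.1) r \ SxV g r₁ v.1).ncard : ℝ))
          ≤ C * (n : ℝ) ^ (-δ)) := by
  have hα : 0 < 1 - alph g := by linarith [alph_lt_one hg]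
  obtain ⟨C₁, hC₁, h₁⟩ := exists_tsum_TnInd_le hg
  obtain ⟨C₂, hC₂, h₂⟩ := exists_tsum_Vr_le hg
  set b : ℝ := 1 / (2 * (g : ℝ) + 1) with hb
  have hb₀ : 0 < b := by positivity
  refine ⟨b / 2, half_pos hb₀, fun s _ lam hlam => ?_⟩
  have hc : 0 ≤ (1 - alph g)⁻¹ * lam ^ (2 * (g : ℝ) + 5) := by positivity
  refine ⟨C₁ * (1 + (1 - alph g)⁻¹ * lam ^ (2 * (g : ℝ) + 5) / (b / 2)) + C₂, by positivity, 16,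
    fun n hn r _ _ hr => ⟨?_, fun r₁ hr₁ => ?_⟩⟩ <;>
  have hn₁ : (1 : ℝ) ≤ n := by exact_mod_cast (by omega : 1 ≤ n)
  · refine (h₁ M lam s n hlam hn r hr).trans ?_
    rw [mul_assoc C₁, add_mul _ C₂, mul_assoc C₁]
    refine le_add_of_le_of_nonneg ?_ (by positivity)
    exact mul_le_mul_of_nonneg_left (one_add_mul_log_mul_rpow_le hb₀ hc hn₁) hC₁.le
  · have hr₀ : 0 < r₁ := by
      have : (0 : ℝ) < r₁ := lt_of_lt_of_le (by positivity) hr₁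
      exact_mod_cast this
    refine (h₂ r₁ hr₀ r hr).trans ?_
    rw [add_mul]
    refine le_add_of_nonneg_of_le (by positivity) ?_
    gcongr
    refine (rpow_neg_le_of_rpow_le hg (by omega) hr₁).trans ?_
    exact Real.rpow_le_rpow_of_exponent_le hn₁ (by linarith)
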